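/- arXiv:1605.01557 — 5 statements merged into one kernel-verified Lean document; each statement's English description precedes it below -/
import Mathlib

section
/- (Proposition 8: monotonicity of the α-fair objective in k under the throughput constraint.) Fix a real α ≥ 1, θ ∈ (0,1), and integers n' ≥ 3 and k with 1 ≤ k ≤ n'−2. If p_s, p_s' ∈ (0, 1/n') satisfy T(p_s, k, n') = θ and T(p_s', k+1, n') = θ, then F_α(p_s, k, n') < F_α(p_s', k+1, n'). In particular, among two-valued controls with n' fixed that satisfy the throughput constraint, the α-fair objective is maximized at k = n'−1. -/
open scoped BigOperators

/-- The larger contention probability `p_l = (1 - k p_s)/(n' - k)`. -/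
noncomputable def plv (ps : ℝ) (k n' : ℕ) : ℝ := (1 - (k : ℝ) * ps) / ((n' : ℝ) - k)

/-- The rate `x_s` of a user contending with probability `p_s`. -/
noncomputable def xsv (ps : ℝ) (k n' : ℕ) : ℝ :=
  ps * (1 - ps) ^ (k - 1) * (1 - plv ps k n') ^ (n' - k)

/-- The rate `x_l` of a user contending with probability `p_l`. -/
noncomputable def xlv (ps : ℝ) (k n' : ℕ) : ℝ :=
  plv ps k n' * (1 - ps) ^ k * (1 - plv ps k n') ^ (n' - k - 1)

/-- The throughput `T(p_s, k, n') = k x_s + (n'-k) x_l`. -/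
noncomputable def Tp (ps : ℝ) (k n' : ℕ) : ℝ :=
  (k : ℝ) * xsv ps k n' + ((n' : ℝ) - k) * xlv ps k n'

/-- The `α`-fair utility function. -/
noncomputable def Ualpha (α z : ℝ) : ℝ :=
  if α = 1 then Real.log z else z ^ (1 - α) / (1 - α)

/-- The `α`-fair objective of the two-valued control, `k U_α(x_s) + (n'-k) U_α(x_l)`. -/
noncomputable def FalphaP (α ps : ℝ) (k n' : ℕ) : ℝ :=
  (k : ℝ) * Ualpha α (xsv ps k n') + ((n' : ℝ) - k) * Ualpha α (xlv ps k n')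

open Set Filter Topology

theorem Ualpha.hasDerivAt (α : ℝ) {z : ℝ} (hz : 0 < z) :
    HasDerivAt (Ualpha α) (z ^ (-α)) z := by
  unfold Ualpha
  by_cases h : α = 1
  · simp only [h, if_true]
    rw [Real.rpow_neg_one]
    exact Real.hasDerivAt_log hz.ne'
  · simp only [h, if_false]
    have h1 : 1 - α ≠ 0 := sub_ne_zero.mpr (Ne.symm h)
    have := (Real.hasDerivAt_rpow_const (x := z) (p := 1 - α) (Or.inl hz.ne')).div_const (1 - α)
    convert! this using 1
    rw [show 1 - α - 1 = -α by ring]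
    field_simp

theorem Ualpha.mul_sub_mul (α : ℝ) {c z w : ℝ} (hc : 0 < c) (hz : 0 < z) (hw : 0 < w) :
    Ualpha α (c * z) - Ualpha α (c * w) = c ^ (1 - α) * (Ualpha α z - Ualpha α w) := by
  unfold Ualpha
  by_cases h : α = 1
  · simp [h, Real.log_mul hc.ne' hz.ne', Real.log_mul hc.ne' hw.ne']
  · simp only [h, if_false]
    rw [Real.mul_rpow hc.le hz.le, Real.mul_rpow hc.le hw.le]
    ring

/-- Tangent-line bound for the power `2 - α`, with a slope that also covers `2 ≤ α`. -/
theorem rpow_two_sub_sub_le {α a b : ℝ} (hα : 1 ≤ α) (ha : 0 < a) (hab : a < b) :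
    b ^ (2 - α) - a ^ (2 - α) ≤ (1 - min (α - 1) 1) * a ^ (1 - α) * (b - a) := by
  rcases le_total α 2 with h | h
  · rw [min_eq_left (by linarith)]
    have hs : -1 ≤ (b - a) / a := by
      have : 0 < (b - a) / a := div_pos (by linarith) ha
      linarith
    have hB := rpow_one_add_le_one_add_mul_self hs (p := 2 - α) (by linarith) (by linarith)
    have hb : b = a * (1 + (b - a) / a) := by field_simp; ring
    have hpos : 0 < a ^ (2 - α) := Real.rpow_pos_of_pos ha _
    have e : a ^ (2 - α) = a ^ (1 - α) * a := by
      rw [← Real.rpow_add_one ha.ne']; congr 1; ring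
    have hb2 : b ^ (2 - α) = a ^ (2 - α) * (1 + (b - a) / a) ^ (2 - α) := by
      conv_lhs => rw [hb]
      rw [Real.mul_rpow ha.le (by linarith)]
    have h3 : b ^ (2 - α) ≤ a ^ (2 - α) * (1 + (2 - α) * ((b - a) / a)) := by
      rw [hb2]; exact mul_le_mul_of_nonneg_left hB hpos.le
    have h4 : a ^ (2 - α) * (1 + (2 - α) * ((b - a) / a)) =
        a ^ (2 - α) + (2 - α) * a ^ (1 - α) * (b - a) := by
      rw [e]; field_simp
    rw [h4] at h3
    linarith
  · rw [min_eq_right (by linarith)]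
    have := Real.rpow_le_rpow_of_nonpos ha hab.le (z := 2 - α) (by linarith)
    linarith

theorem strictConvexOn_rpow_add_quadratic {α κ : ℝ} (lam μ : ℝ) (hα : 1 ≤ α)
    (hκ : min (α - 1) 1 < 2 * κ) :
    StrictConvexOn ℝ (Ioi 0) fun u : ℝ =>
      u ^ (-α) + 2 * u ^ (1 - α) + u ^ (2 - α) + (κ * u ^ 2 + lam * u + μ) := by
  have d0 : ∀ r u : ℝ, 0 < u → HasDerivAt (fun u : ℝ => u ^ r) (r * u ^ (r - 1)) u :=
    fun r u hu => Real.hasDerivAt_rpow_const (Or.inl hu.ne')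
  have d1 : ∀ u : ℝ, 0 < u → HasDerivAt (fun u : ℝ =>
      u ^ (-α) + 2 * u ^ (1 - α) + u ^ (2 - α) + (κ * u ^ 2 + lam * u + μ))
      (-α * u ^ (-α - 1) + 2 * ((1 - α) * u ^ (-α)) + (2 - α) * u ^ (1 - α)
        + (2 * κ * u + lam)) u := by
    intro u hu
    have hq : HasDerivAt (fun u : ℝ => κ * u ^ 2 + lam * u + μ) (2 * κ * u + lam) u := by
      convert! (((hasDerivAt_pow 2 u).const_mul κ).add ((hasDerivAt_id u).const_mul lam)).add_const μ
        using 1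
      simp; ring
    convert! (((d0 (-α) u hu).add ((d0 (1 - α) u hu).const_mul 2)).add (d0 (2 - α) u hu)).add hq
      using 1
    rw [show 1 - α - 1 = -α by ring, show 2 - α - 1 = 1 - α by ring]
  have d2 : ∀ u : ℝ, 0 < u → HasDerivAt (fun u : ℝ =>
      -α * u ^ (-α - 1) + 2 * ((1 - α) * u ^ (-α)) + (2 - α) * u ^ (1 - α) + (2 * κ * u + lam))
      (α * (α + 1) * u ^ (-α - 2) + 2 * (α - 1) * α * u ^ (-α - 1)
        - (2 - α) * (α - 1) * u ^ (-α) + 2 * κ) u := by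
    intro u hu
    have hq : HasDerivAt (fun u : ℝ => 2 * κ * u + lam) (2 * κ) u := by
      simpa using ((hasDerivAt_id u).const_mul (2 * κ)).add_const lam
    convert! ((((d0 (-α - 1) u hu).const_mul (-α)).add
      (((d0 (-α) u hu).const_mul (1 - α)).const_mul 2)).add
      ((d0 (1 - α) u hu).const_mul (2 - α))).add hq using 1
    rw [show -α - 1 - 1 = -α - 2 by ring, show 1 - α - 1 = -α by ring]
    ring
  refine strictConvexOn_of_deriv2_pos' (convex_Ioi 0)
    (fun u hu => (d1 u hu).continuousAt.continuousWithinAt) fun u hu => ?_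
  have hu' : (0 : ℝ) < u := hu
  have e : deriv^[2] (fun u : ℝ =>
      u ^ (-α) + 2 * u ^ (1 - α) + u ^ (2 - α) + (κ * u ^ 2 + lam * u + μ)) u =
      α * (α + 1) * u ^ (-α - 2) + 2 * (α - 1) * α * u ^ (-α - 1)
        - (2 - α) * (α - 1) * u ^ (-α) + 2 * κ := by
    simp only [Function.iterate_succ, Function.iterate_zero, Function.comp_apply, id]
    have : deriv (fun u : ℝ =>
      u ^ (-α) + 2 * u ^ (1 - α) + u ^ (2 - α) + (κ * u ^ 2 + lam * u + μ)) =ᶠ[𝓝 u]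
      fun u => -α * u ^ (-α - 1) + 2 * ((1 - α) * u ^ (-α)) + (2 - α) * u ^ (1 - α)
        + (2 * κ * u + lam) := by
      filter_upwards [Ioi_mem_nhds hu'] with x hx using (d1 x hx).deriv
    rw [this.deriv_eq, (d2 u hu').deriv]
  rw [e]
  have p0 : 0 < u ^ (-α) := Real.rpow_pos_of_pos hu' _
  have p1 : 0 < u ^ (-α - 1) := Real.rpow_pos_of_pos hu' _
  have p2 : 0 < u ^ (-α - 2) := Real.rpow_pos_of_pos hu' _
  have q2 : 0 ≤ α * (α + 1) * u ^ (-α - 2) := by positivity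
  have hα1 : 0 ≤ α - 1 := by linarith
  have q1 : 0 ≤ 2 * (α - 1) * α * u ^ (-α - 1) := by positivity
  rcases le_total α 2 with h | h
  · rw [min_eq_left (by linarith)] at hκ
    rcases le_total u 1 with h1 | h1
    · have : u ^ (-α) ≤ u ^ (-α - 1) :=
        Real.rpow_le_rpow_of_exponent_ge hu' h1 (by linarith)
      have h5 : (2 - α) * u ^ (-α) ≤ 2 * α * u ^ (-α - 1) :=
        mul_le_mul (by linarith) this p0.le (by linarith)
      nlinarith [mul_le_mul_of_nonneg_left h5 hα1]
    · have : u ^ (-α) ≤ 1 := Real.rpow_le_one_of_one_le_of_nonpos h1 (by linarith)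
      have h5 : (2 - α) * u ^ (-α) ≤ 1 := by nlinarith
      nlinarith [mul_le_mul_of_nonneg_left h5 hα1]
  · rw [min_eq_right (by linarith)] at hκ
    have : 0 ≤ (α - 2) * (α - 1) * u ^ (-α) := mul_nonneg (mul_nonneg (by linarith) hα1) p0.le
    linarith

theorem rpow_add_quadratic_neg_of_eq_zero {α κ lam μ a b c Q m : ℝ} (hα : 1 ≤ α) (ha : 0 < a)
    (ha1 : a ≤ 1) (hm : m ∈ Ioo a b) (hc : 0 < c) (hc2 : c ≤ 2) (hQ : a ^ (1 - α) < Q)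
    (hκ : c * κ * (b - a) = Q * (b - a) -
      ((b ^ (-α) + 2 * b ^ (1 - α) + b ^ (2 - α)) - (a ^ (-α) + 2 * a ^ (1 - α) + a ^ (2 - α))))
    (h0a : a ^ (-α) + 2 * a ^ (1 - α) + a ^ (2 - α) + (κ * a ^ 2 + lam * a + μ) = 0)
    (h0b : b ^ (-α) + 2 * b ^ (1 - α) + b ^ (2 - α) + (κ * b ^ 2 + lam * b + μ) = 0) :
    m ^ (-α) + 2 * m ^ (1 - α) + m ^ (2 - α) + (κ * m ^ 2 + lam * m + μ) < 0 := by
  have hab : a < b := hm.1.trans hm.2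
  have h1 : b ^ (-α) ≤ a ^ (-α) := Real.rpow_le_rpow_of_nonpos ha hab.le (by linarith)
  have h2 : b ^ (1 - α) ≤ a ^ (1 - α) := Real.rpow_le_rpow_of_nonpos ha hab.le (by linarith)
  have h3 := rpow_two_sub_sub_le hα ha hab
  have h4 : 1 ≤ a ^ (1 - α) := Real.one_le_rpow_of_pos_of_le_one_of_nonpos ha ha1 (by linarith)
  have hδ : 0 ≤ min (α - 1) 1 := le_min (by linarith) zero_le_one
  have hba : 0 < b - a := sub_pos.mpr hab
  have h5 : min (α - 1) 1 * (b - a) < c * κ * (b - a) := by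
    have : min (α - 1) 1 * (b - a) ≤ min (α - 1) 1 * a ^ (1 - α) * (b - a) := by
      apply mul_le_mul_of_nonneg_right _ hba.le
      nlinarith
    have : a ^ (1 - α) * (b - a) < Q * (b - a) := mul_lt_mul_of_pos_right hQ hba
    nlinarith
  have h6 : min (α - 1) 1 < c * κ := lt_of_mul_lt_mul_right h5 hba.le
  have hκ0 : 0 < κ := pos_of_mul_pos_right (hδ.trans_lt h6) hc.le
  have hconv := strictConvexOn_rpow_add_quadratic lam μ hα
    (h6.trans_le (mul_le_mul_of_nonneg_right hc2 hκ0.le))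
  have := hconv.lt_on_openSegment (x := a) (y := b) ha (ha.trans hab) hab.ne
    (z := m) (by rwa [openSegment_eq_Ioo hab])
  simpa only [h0a, h0b, max_self] using this

/-- The odds `p / (1 - p)` of a probability `p`. -/
noncomputable def odds (p : ℝ) : ℝ := p / (1 - p)

theorem odds_pos {p : ℝ} (h0 : 0 < p) (h1 : p < 1) : 0 < odds p :=
  div_pos h0 (by linarith)

theorem odds_lt_odds {p q : ℝ} (hpq : p < q) (h1 : q < 1) : odds p < odds q := by
  unfold odds
  rw [div_lt_div_iff₀ (by linarith) (by linarith)]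
  nlinarith

theorem one_add_odds {p : ℝ} (h1 : p < 1) : 1 + odds p = 1 / (1 - p) := by
  have : 1 - p ≠ 0 := by linarith
  unfold odds
  field_simp
  ring

theorem odds.hasDerivAt {p : ℝ} (h1 : p < 1) : HasDerivAt odds ((1 + odds p) ^ 2) p := by
  have h : 1 - p ≠ 0 := by linarith
  rw [one_add_odds h1]
  unfold odds
  convert! (hasDerivAt_id p).div ((hasDerivAt_id p).const_sub 1) h using 1
  simp only [id]
  field_simp
  ring

theorem hasDerivAt_log_one_sub {p : ℝ} (h1 : p < 1) :
    HasDerivAt (fun q => Real.log (1 - q)) (-(1 + odds p)) p := by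
  rw [one_add_odds h1]
  convert! ((hasDerivAt_id p).const_sub 1).log (by simp; linarith) using 1
  simp [neg_div]

theorem mul_odds_le_add {w p : ℝ} (h0 : 0 ≤ p) (h1 : p < 1) (hw : w * p ≤ 1) :
    w * odds p ≤ odds p + w * p := by
  have h : 0 < 1 - p := by linarith
  have : odds p = p + p * odds p := by unfold odds; field_simp; ring
  have h2 : 0 ≤ odds p := div_nonneg h0 h.le
  have h3 : w * odds p = w * p + w * p * odds p := by linear_combination w * this
  nlinarith

/-- `log (1 - p) + odds p / S`, the contribution of `p` to the first variation of the logarithm of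
the throughput when the sum of all odds is `S`. -/
noncomputable def logVar (S p : ℝ) : ℝ := Real.log (1 - p) + odds p / S

/-- The derivative of `logVar S`. -/
noncomputable def logVarDeriv (S p : ℝ) : ℝ := -(1 + odds p) + (1 + odds p) ^ 2 / S

theorem logVar.hasDerivAt (S : ℝ) {p : ℝ} (h1 : p < 1) :
    HasDerivAt (logVar S) (logVarDeriv S p) p :=
  (hasDerivAt_log_one_sub h1).add ((odds.hasDerivAt h1).div_const S)

theorem logVarDeriv_sub {S : ℝ} (hS : 0 < S) (p q : ℝ) :
    logVarDeriv S q - logVarDeriv S p =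
      (odds q - odds p) * (2 + odds p + odds q - S) / S := by
  unfold logVarDeriv
  field_simp
  ring

/-- A two-point quadrature rule on `[a, b]` that is exact for `1` and `logVarDeriv S` underestimates
the integral of the derivative of the fairness loss `-U_α (odds p) - Q log (1 - p)`. -/
theorem quadrature_lt {α a b S Q X Y : ℝ} (hα : 1 ≤ α) (ha : 0 < a) (hab : a < b) (hb : b < 1)
    (ha1 : odds a ≤ 1) (hS : 0 < S) (hc : 0 < 2 + odds a + odds b - S)
    (hc2 : 2 + odds a + odds b - S ≤ 2) (hQ : odds a ^ (1 - α) < Q) (hXY : X + Y = b - a)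
    (hL : X * logVarDeriv S a + Y * logVarDeriv S b = logVar S b - logVar S a) :
    X * (-(odds a ^ (-α) * (1 + odds a) ^ 2) + Q * (1 + odds a)) +
        Y * (-(odds b ^ (-α) * (1 + odds b) ^ 2) + Q * (1 + odds b)) <
      (-Ualpha α (odds b) - Q * Real.log (1 - b)) -
        (-Ualpha α (odds a) - Q * Real.log (1 - a)) := by
  set j' : ℝ → ℝ := fun p => -(odds p ^ (-α) * (1 + odds p) ^ 2) + Q * (1 + odds p) with hj'
  have hj : ∀ p, 0 < p → p < 1 →
      HasDerivAt (fun p => -Ualpha α (odds p) - Q * Real.log (1 - p)) (j' p) p := by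
    intro p h0 h1
    convert! (((Ualpha.hasDerivAt α (odds_pos h0 h1)).comp p (odds.hasDerivAt h1)).neg).sub
      ((hasDerivAt_log_one_sub h1).const_mul Q) using 1
    simp only [hj']
    ring
  have hu := odds_lt_odds hab hb
  have hd := logVarDeriv_sub hS a b
  have hd0 : 0 < logVarDeriv S b - logVarDeriv S a := by
    rw [hd]; exact div_pos (mul_pos (sub_pos.mpr hu) hc) hS
  set c₁ := (j' b - j' a) / (logVarDeriv S b - logVarDeriv S a) with hc₁
  have hc₁' : c₁ * (logVarDeriv S b - logVarDeriv S a) = j' b - j' a :=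
    div_mul_cancel₀ _ hd0.ne'
  set c₀ := j' a - c₁ * logVarDeriv S a with hc₀
  have hexp : ∀ u : ℝ, 0 < u →
      u ^ (-α) * (1 + u) ^ 2 = u ^ (-α) + 2 * u ^ (1 - α) + u ^ (2 - α) := by
    intro u hu
    have e1 : u ^ (1 - α) = u ^ (-α) * u := by
      rw [← Real.rpow_add_one hu.ne']; congr 1; ring
    have e2 : u ^ (2 - α) = u ^ (-α) * u * u := by
      rw [← Real.rpow_add_one hu.ne', ← Real.rpow_add_one hu.ne']; congr 1; ring
    rw [e1, e2]; ring
  have hform : ∀ p, 0 < p → p < 1 → c₀ + c₁ * logVarDeriv S p - j' p =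
      odds p ^ (-α) + 2 * odds p ^ (1 - α) + odds p ^ (2 - α) + (c₁ / S * odds p ^ 2 +
        (-c₁ + 2 * c₁ / S - Q) * odds p + (c₀ - c₁ + c₁ / S - Q)) := by
    intro p h0 h1
    rw [← hexp _ (odds_pos h0 h1)]
    simp only [hj', logVarDeriv]
    ring
  have hzb : c₀ + c₁ * logVarDeriv S b - j' b = 0 := by rw [hc₀]; linarith
  have hza : c₀ + c₁ * logVarDeriv S a - j' a = 0 := by rw [hc₀]; ring
  have hneg : ∀ m ∈ Ioo a b, c₀ + c₁ * logVarDeriv S m - j' m < 0 := by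
    intro m hm
    rw [hform m (ha.trans hm.1) (hm.2.trans hb)]
    refine rpow_add_quadratic_neg_of_eq_zero hα (odds_pos ha (hab.trans hb)) ha1
      ⟨odds_lt_odds hm.1 (hm.2.trans hb), odds_lt_odds hm.2 hb⟩ hc hc2 hQ ?_ ?_ ?_
    · rw [← hexp _ (odds_pos ha (hab.trans hb)), ← hexp _ (odds_pos (ha.trans hab) hb)]
      rw [hd] at hc₁'
      simp only [hj'] at hc₁'
      linear_combination hc₁'
    · rw [← hform a ha (hab.trans hb), hza]
    · rw [← hform b (ha.trans hab) hb, hzb]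
  have hΨ : ∀ m ∈ Icc a b, HasDerivAt
      (fun m => c₀ * m + c₁ * logVar S m - (-Ualpha α (odds m) - Q * Real.log (1 - m)))
      (c₀ + c₁ * logVarDeriv S m - j' m) m := by
    intro m hm
    have h1 : m < 1 := hm.2.trans_lt hb
    have h0 : 0 < m := ha.trans_le hm.1
    convert! (((hasDerivAt_id m).const_mul c₀).add ((logVar.hasDerivAt S h1).const_mul c₁)).sub
      (hj m h0 h1) using 1
    simp
  have hanti := strictAntiOn_of_deriv_neg (convex_Icc a b)
    (fun m hm => (hΨ m hm).continuousAt.continuousWithinAt) (fun m hm => by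
      rw [interior_Icc] at hm
      rw [(hΨ m (Ioo_subset_Icc_self hm)).deriv]
      exact hneg m hm)
  have hfin := hanti (left_mem_Icc.mpr hab.le) (right_mem_Icc.mpr hab.le) hab
  simp only at hfin
  have hsum : X * j' a + Y * j' b = c₀ * (b - a) + c₁ * (logVar S b - logVar S a) := by
    rw [← hXY, ← hL]
    have e1 : j' a = c₀ + c₁ * logVarDeriv S a := by linarith
    have e2 : j' b = c₀ + c₁ * logVarDeriv S b := by linarith
    rw [e1, e2]; ring
  change X * j' a + Y * j' b < _
  rw [hsum]
  linarith

/-- The sum of the odds of a control with `k` components `a` and `n - k` components `b`. -/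
noncomputable def oddsSum (n k a b : ℝ) : ℝ := k * odds a + (n - k) * odds b

/-- The logarithm of the throughput of a control with `k` components `a` and `n - k` components
`b`, for real `k`. -/
noncomputable def logThroughput (n k a b : ℝ) : ℝ :=
  k * Real.log (1 - a) + (n - k) * Real.log (1 - b) + Real.log (oddsSum n k a b)

/-- The `α`-fair objective of a control with `k` components `a` and `n - k` components `b`,
normalized to have throughput `θ`. -/
noncomputable def fairObjective (α θ n k a b : ℝ) : ℝ :=
  k * Ualpha α (θ / oddsSum n k a b * odds a) + (n - k) * Ualpha α (θ / oddsSum n k a b * odds b)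

/-- `k` components `a` and `n - k` larger components `b` form a probability vector. -/
structure IsTwoValued (n k a b : ℝ) : Prop where
  one_le : 1 ≤ k
  one_le_sub : 1 ≤ n - k
  pos : 0 < a
  lt : a < b
  lt_one : b < 1
  sum_eq : k * a + (n - k) * b = 1

namespace IsTwoValued

variable {n k a b : ℝ} (h : IsTwoValued n k a b)

include h

theorem left_lt_one : a < 1 := h.lt.trans h.lt_one

theorem odds_left_pos : 0 < odds a := odds_pos h.pos h.left_lt_one

theorem odds_right_pos : 0 < odds b := odds_pos (h.pos.trans h.lt) h.lt_one

theorem odds_left_le_one : odds a ≤ 1 := by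
  have := h.left_lt_one
  unfold odds
  rw [div_le_one (by linarith)]
  nlinarith [h.one_le, h.one_le_sub, h.pos, h.lt, h.sum_eq]

theorem odds_add_odds_le : odds a + odds b ≤ oddsSum n k a b := by
  unfold oddsSum
  nlinarith [h.one_le, h.one_le_sub, h.odds_left_pos, h.odds_right_pos]

theorem oddsSum_pos : 0 < oddsSum n k a b :=
  (add_pos h.odds_left_pos h.odds_right_pos).trans_le h.odds_add_odds_le

theorem oddsSum_le : oddsSum n k a b ≤ 1 + odds a + odds b := by
  have h1 := h.one_le
  have h2 := h.one_le_sub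
  have h3 := h.pos
  have h4 := h.pos.trans h.lt
  have h5 := h.sum_eq
  have h6 : 0 ≤ k * a := by positivity
  have h7 : 0 ≤ (n - k) * b := by positivity
  have := mul_odds_le_add (w := k) h3.le h.left_lt_one (by linarith)
  have := mul_odds_le_add (w := n - k) h4.le h.lt_one (by linarith)
  unfold oddsSum
  linarith

theorem logVarDeriv_lt {m : ℝ} (ham : a ≤ m) (hmb : m < b) :
    logVarDeriv (oddsSum n k a b) m < logVarDeriv (oddsSum n k a b) b := by
  have h1 := logVarDeriv_sub h.oddsSum_pos m b
  have h2 := odds_lt_odds hmb h.lt_one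
  have h3 : odds a ≤ odds m := by
    rcases ham.eq_or_lt with rfl | h'
    · exact le_rfl
    · exact (odds_lt_odds h' (hmb.trans h.lt_one)).le
  have : 0 < (odds b - odds m) * (2 + odds m + odds b - oddsSum n k a b) / oddsSum n k a b :=
    div_pos (mul_pos (by linarith) (by linarith [h.oddsSum_le])) h.oddsSum_pos
  linarith

end IsTwoValued

section Curve

variable {n t k' a' b' : ℝ} {k a b : ℝ → ℝ}

theorem oddsSum.hasDerivAt (hk : HasDerivAt k k' t) (ha : HasDerivAt a a' t)
    (hb : HasDerivAt b b' t) (ha1 : a t < 1) (hb1 : b t < 1) :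
    HasDerivAt (fun s => oddsSum n (k s) (a s) (b s))
      (k' * (odds (a t) - odds (b t)) + k t * ((1 + odds (a t)) ^ 2 * a') +
        (n - k t) * ((1 + odds (b t)) ^ 2 * b')) t := by
  unfold oddsSum
  convert! (hk.mul ((odds.hasDerivAt ha1).comp t ha)).add
    ((hk.const_sub n).mul ((odds.hasDerivAt hb1).comp t hb)) using 1
  simp only [Function.comp_apply]
  ring

theorem logThroughput.hasDerivAt (hk : HasDerivAt k k' t) (ha : HasDerivAt a a' t)
    (hb : HasDerivAt b b' t) (ha1 : a t < 1) (hb1 : b t < 1)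
    (hS : 0 < oddsSum n (k t) (a t) (b t)) :
    HasDerivAt (fun s => logThroughput n (k s) (a s) (b s))
      (k' * (logVar (oddsSum n (k t) (a t) (b t)) (a t) -
          logVar (oddsSum n (k t) (a t) (b t)) (b t)) +
        k t * (logVarDeriv (oddsSum n (k t) (a t) (b t)) (a t) * a') +
        (n - k t) * (logVarDeriv (oddsSum n (k t) (a t) (b t)) (b t) * b')) t := by
  unfold logThroughput
  convert! ((hk.mul ((hasDerivAt_log_one_sub ha1).comp t ha)).add
    ((hk.const_sub n).mul ((hasDerivAt_log_one_sub hb1).comp t hb))).add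
    ((oddsSum.hasDerivAt hk ha hb ha1 hb1).log hS.ne') using 1
  simp only [logVar, logVarDeriv, Function.comp_apply]
  field_simp
  ring

/-- Along a curve of two-valued controls of constant throughput, parametrized by `k`, the
`α`-fair objective has positive derivative. -/
theorem exists_pos_hasDerivAt_fairObjective {α θ : ℝ} (hα : 1 ≤ α) (hθ : 0 < θ)
    (hk : HasDerivAt k 1 t) (ha : HasDerivAt a a' t) (hb : HasDerivAt b b' t)
    (h : IsTwoValued n (k t) (a t) (b t))
    (hsum : HasDerivAt (fun s => k s * a s + (n - k s) * b s) 0 t)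
    (hT : HasDerivAt (fun s => logThroughput n (k s) (a s) (b s)) 0 t) :
    ∃ d, 0 < d ∧ HasDerivAt (fun s => fairObjective α θ n (k s) (a s) (b s)) d t := by
  have ha1 := h.left_lt_one
  have hb1 := h.lt_one
  have hua := h.odds_left_pos
  have hub := h.odds_right_pos
  have hS := h.oddsSum_pos
  have e1 := hsum.unique ((hk.mul ha).add ((hk.const_sub n).mul hb))
  have e2 := hT.unique (logThroughput.hasDerivAt hk ha hb ha1 hb1 hS)
  have hSd := oddsSum.hasDerivAt (n := n) hk ha hb ha1 hb1
  set S' := 1 * (odds (a t) - odds (b t)) + k t * ((1 + odds (a t)) ^ 2 * a') +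
        (n - k t) * ((1 + odds (b t)) ^ 2 * b') with hS'
  set S := oddsSum n (k t) (a t) (b t) with hSdef
  set Q := k t * odds (a t) ^ (1 - α) + (n - k t) * odds (b t) ^ (1 - α) with hQ
  have hpa := Real.rpow_pos_of_pos hua (1 - α)
  have hpb := Real.rpow_pos_of_pos hub (1 - α)
  have hQ1 : odds (a t) ^ (1 - α) < Q := by
    nlinarith [h.one_le, h.one_le_sub]
  have hquad := quadrature_lt (X := k t * a') (Y := (n - k t) * b') hα h.pos h.lt hb1
    h.odds_left_le_one hS (by linarith [h.oddsSum_le]) (by linarith [h.odds_add_odds_le]) hQ1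
    (by linarith) (by linarith)
  have hr : 0 < θ / S := div_pos hθ hS
  have hrd : HasDerivAt (fun s => θ / oddsSum n (k s) (a s) (b s)) (-(θ / S) * (S' / S)) t := by
    convert! (hasDerivAt_const t θ).div hSd hS.ne' using 1
    rw [← hSdef]
    field_simp
    ring
  have hya := (Ualpha.hasDerivAt α (mul_pos hr hua)).comp t
    (hrd.mul ((odds.hasDerivAt ha1).comp t ha))
  have hyb := (Ualpha.hasDerivAt α (mul_pos hr hub)).comp t
    (hrd.mul ((odds.hasDerivAt hb1).comp t hb))
  have hF := (hk.mul hya).add ((hk.const_sub n).mul hyb)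
  refine ⟨_, ?_, hF⟩
  have hU := Ualpha.mul_sub_mul α hr hua hub
  have hlogS : S' / S = -(Real.log (1 - a t) - Real.log (1 - b t)) +
      k t * a' * (1 + odds (a t)) + (n - k t) * b' * (1 + odds (b t)) := by
    simp only [logVar, logVarDeriv] at e2
    rw [hS']
    field_simp at e2 ⊢
    linarith
  have hpow : ∀ u : ℝ, 0 < u → (θ / S * u) ^ (-α) * (θ / S) = (θ / S) ^ (1 - α) * u ^ (-α) := by
    intro u hu
    rw [Real.mul_rpow hr.le hu.le, show 1 - α = -α + 1 by ring, Real.rpow_add_one hr.ne']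
    ring
  have hpu : ∀ u : ℝ, 0 < u → u ^ (-α) * u = u ^ (1 - α) := by
    intro u hu
    rw [show 1 - α = -α + 1 by ring, Real.rpow_add_one hu.ne']
  have hA := hpow _ hua
  have hB := hpow _ hub
  have hA' := hpu _ hua
  have hB' := hpu _ hub
  have key : 0 < (θ / S) ^ (1 - α) * (Ualpha α (odds (a t)) - Ualpha α (odds (b t)) +
      k t * (odds (a t) ^ (-α) * ((1 + odds (a t)) ^ 2 * a')) +
      (n - k t) * (odds (b t) ^ (-α) * ((1 + odds (b t)) ^ 2 * b')) - S' / S * Q) := by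
    apply mul_pos (Real.rpow_pos_of_pos hr _)
    rw [hlogS]
    linarith
  refine key.trans_eq ?_
  simp only [Function.comp_apply, Pi.mul_apply]
  rw [← hSdef]
  rw [hQ, ← hA', ← hB']
  linear_combination -hU - (k t * ((1 + odds (a t)) ^ 2 * a' - S' / S * odds (a t))) * hA
    - ((n - k t) * ((1 + odds (b t)) ^ 2 * b' - S' / S * odds (b t))) * hB

end Curve

/-- The implicit function theorem for level curves in the plane. -/
theorem exists_hasDerivAt_level_curve {f : ℝ × ℝ → ℝ} {k p d : ℝ}
    (hf : ContDiffAt ℝ 1 f (k, p)) (hd : HasDerivAt (fun x => f (k, x)) d p) (hd0 : d ≠ 0) :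
    ∃ (ψ : ℝ → ℝ) (ψ' : ℝ), HasDerivAt ψ ψ' k ∧ ψ k = p ∧ ∀ᶠ x in 𝓝 k, f (x, ψ x) = f (k, p) := by
  have hs := hf.hasStrictFDerivAt one_ne_zero
  have hcomp : fderiv ℝ f (k, p) (0, 1) = d := by
    have h1 : HasDerivAt (fun x : ℝ => (k, x)) ((0 : ℝ), (1 : ℝ)) p :=
      (hasDerivAt_const p k).prodMk (hasDerivAt_id p)
    exact (hs.hasFDerivAt.comp_hasDerivAt p h1).unique hd
  have hinv : (fderiv ℝ f (k, p) ∘L .inr ℝ ℝ ℝ).IsInvertible := by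
    refine ⟨ContinuousLinearEquiv.unitsEquivAut ℝ (Units.mk0 d hd0), ?_⟩
    ext
    simp [hcomp]
  refine ⟨hs.implicitFunctionOfProdDomain hinv, _,
    (hs.hasStrictFDerivAt_implicitFunctionOfProdDomain hinv).hasFDerivAt.hasDerivAt, ?_,
    hs.eventually_apply_implicitFunctionOfProdDomain hinv⟩
  exact (hs.eventually_apply_eq_iff_implicitFunctionOfProdDomain hinv).self_of_nhds.mp rfl

/-- The value of the `n - k` other components of a control with `k` components equal to `p`. -/
noncomputable def otherValue (n k p : ℝ) : ℝ := (1 - k * p) / (n - k)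

theorem otherValue_one_div {n k : ℝ} (hn : n ≠ 0) (hk : n - k ≠ 0) :
    otherValue n k (1 / n) = 1 / n := by
  unfold otherValue
  field_simp

theorem otherValue.hasDerivAt_right (n k p : ℝ) :
    HasDerivAt (otherValue n k) (-k / (n - k)) p := by
  unfold otherValue
  convert! (((hasDerivAt_id p).const_mul k).const_sub 1).div_const (n - k) using 1
  simp

theorem otherValue.hasDerivAt {n t k' p' : ℝ} {k p : ℝ → ℝ} (hk : HasDerivAt k k' t)
    (hp : HasDerivAt p p' t) (hn : n - k t ≠ 0) :
    HasDerivAt (fun s => otherValue n (k s) (p s))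
      ((k' * (otherValue n (k t) (p t) - p t) - k t * p') / (n - k t)) t := by
  unfold otherValue
  convert! ((hk.mul hp).const_sub 1).div (hk.const_sub n) hn using 1
  simp only [Pi.mul_apply]
  field_simp
  ring

theorem isTwoValued_otherValue {n k p : ℝ} (hk : 1 ≤ k) (hkn : k ≤ n - 1)
    (hp : p ∈ Ioo 0 (1 / n)) : IsTwoValued n k p (otherValue n k p) := by
  have hnk : 0 < n - k := by linarith
  have hn : 0 < n := by linarith
  have hp1 := (lt_div_iff₀ hn).mp hp.2
  have hp0 : 0 < p := hp.1
  refine ⟨hk, by linarith, hp.1, ?_, ?_, ?_⟩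
  · unfold otherValue
    rw [lt_div_iff₀ hnk]
    linarith
  · unfold otherValue
    rw [div_lt_one hnk]
    nlinarith
  · unfold otherValue
    field_simp
    ring

theorem strictAntiOn_logThroughput {n k : ℝ} (hk : 1 ≤ k) (hkn : k ≤ n - 1) :
    StrictAntiOn (fun p => logThroughput n k p (otherValue n k p)) (Ioc 0 (1 / n)) ∧
      ContinuousOn (fun p => logThroughput n k p (otherValue n k p)) (Ioc 0 (1 / n)) ∧
      ∀ p ∈ Ioo 0 (1 / n), ∃ d < 0,
        HasDerivAt (fun p => logThroughput n k p (otherValue n k p)) d p := by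
  have hn : 0 < n := by linarith
  have hnk : 0 < n - k := by linarith
  have hD : ∀ p ∈ Ioo 0 (1 / n), ∃ d < 0,
      HasDerivAt (fun p => logThroughput n k p (otherValue n k p)) d p := by
    intro p hp
    have h := isTwoValued_otherValue hk hkn hp
    refine ⟨_, ?_, logThroughput.hasDerivAt (hasDerivAt_const p k) (hasDerivAt_id p)
      (otherValue.hasDerivAt_right n k p) h.left_lt_one h.lt_one h.oddsSum_pos⟩
    have hlt := h.logVarDeriv_lt le_rfl h.lt
    have e : ∀ x : ℝ, (n - k) * (x * (-k / (n - k))) = - (k * x) := by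
      intro x; field_simp
    rw [e]
    nlinarith
  have hC : ContinuousOn (fun p => logThroughput n k p (otherValue n k p)) (Ioc 0 (1 / n)) := by
    intro p hp
    rcases hp.2.eq_or_lt with rfl | hlt
    · have e := otherValue_one_div hn.ne' hnk.ne'
      have h1 : 1 / n < 1 := by rw [div_lt_one hn]; linarith
      refine (logThroughput.hasDerivAt (hasDerivAt_const _ k) (hasDerivAt_id _)
        (otherValue.hasDerivAt_right n k _) h1 (by rwa [e]) ?_).continuousAt.continuousWithinAt
      rw [e]
      have := odds_pos hp.1 h1
      simp only [id, oddsSum]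
      nlinarith
    · obtain ⟨d, -, hd⟩ := hD p ⟨hp.1, hlt⟩
      exact hd.continuousAt.continuousWithinAt
  refine ⟨strictAntiOn_of_deriv_neg (convex_Ioc _ _) hC fun p hp => ?_, hC, hD⟩
  rw [interior_Ioc] at hp
  obtain ⟨d, hd0, hd⟩ := hD p hp
  rwa [hd.deriv]

theorem strictMonoOn_logThroughput {n p : ℝ} (hp : p ∈ Ioo 0 (1 / n)) :
    StrictMonoOn (fun k => logThroughput n k p (otherValue n k p)) (Icc 1 (n - 1)) := by
  have hD : ∀ k ∈ Icc 1 (n - 1), ∃ d > 0,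
      HasDerivAt (fun k => logThroughput n k p (otherValue n k p)) d k := by
    intro k hk
    have h := isTwoValued_otherValue hk.1 hk.2 hp
    have hnk : n - k ≠ 0 := by linarith [h.one_le_sub]
    refine ⟨_, ?_, logThroughput.hasDerivAt (hasDerivAt_id k) (hasDerivAt_const k p)
      (otherValue.hasDerivAt (hasDerivAt_id k) (hasDerivAt_const k p) hnk)
      h.left_lt_one h.lt_one h.oddsSum_pos⟩
    set b := otherValue n k p
    set S := oddsSum n k p b
    obtain ⟨m, hm, hme⟩ := exists_hasDerivAt_eq_slope (logVar S) (logVarDeriv S) h.lt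
      (fun x hx => (logVar.hasDerivAt S (hx.2.trans_lt h.lt_one)).continuousAt.continuousWithinAt)
      (fun x hx => logVar.hasDerivAt S (hx.2.trans h.lt_one))
    have hlt : logVarDeriv S m < logVarDeriv S b := h.logVarDeriv_lt hm.1.le hm.2
    rw [hme, div_lt_iff₀ (sub_pos.mpr h.lt)] at hlt
    have e : (n - k) * (logVarDeriv S b * ((1 * (b - p) - k * 0) / (n - k))) =
        logVarDeriv S b * (b - p) := by
      field_simp
      ring
    rw [e]
    linarith
  refine strictMonoOn_of_deriv_pos (convex_Icc _ _) (fun k hk => ?_) fun k hk => ?_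
  · obtain ⟨d, -, hd⟩ := hD k hk
    exact hd.continuousAt.continuousWithinAt
  · obtain ⟨d, hd0, hd⟩ := hD k (interior_subset hk)
    rwa [hd.deriv]

theorem contDiffAt_logThroughput {n k p : ℝ} (h : IsTwoValued n k p (otherValue n k p)) :
    ContDiffAt ℝ 1 (fun q : ℝ × ℝ => logThroughput n q.1 q.2 (otherValue n q.1 q.2)) (k, p) := by
  have h1 : (1 : ℝ) - p ≠ 0 := by linarith [h.left_lt_one]
  have h2 : 1 - otherValue n k p ≠ 0 := by linarith [h.lt_one]
  have h3 : n - k ≠ 0 := by linarith [h.one_le_sub]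
  have hf : ContDiffAt ℝ 1 (fun q : ℝ × ℝ => q.1) (k, p) := contDiffAt_fst
  have hs : ContDiffAt ℝ 1 (fun q : ℝ × ℝ => q.2) (k, p) := contDiffAt_snd
  have hb : ContDiffAt ℝ 1 (fun q : ℝ × ℝ => otherValue n q.1 q.2) (k, p) :=
    (contDiffAt_const.sub (hf.mul hs)).div (contDiffAt_const.sub hf) h3
  have hS : ContDiffAt ℝ 1 (fun q : ℝ × ℝ => oddsSum n q.1 q.2 (otherValue n q.1 q.2)) (k, p) :=
    (hf.mul (hs.div (contDiffAt_const.sub hs) h1)).add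
      ((contDiffAt_const.sub hf).mul (hb.div (contDiffAt_const.sub hb) h2))
  exact ((hf.mul ((contDiffAt_const.sub hs).log h1)).add
    ((contDiffAt_const.sub hf).mul ((contDiffAt_const.sub hb).log h2))).add
    (hS.log h.oddsSum_pos.ne')

theorem exists_logThroughput_eq {n k₀ k p₀ : ℝ} (hk₀ : 1 ≤ k₀) (hk : k₀ ≤ k) (hkn : k ≤ n - 1)
    (hp₀ : p₀ ∈ Ioo 0 (1 / n)) :
    ∃ p ∈ Ioo 0 (1 / n), logThroughput n k p (otherValue n k p) =
      logThroughput n k₀ p₀ (otherValue n k₀ p₀) := by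
  have hn : 0 < n := by linarith
  obtain ⟨hanti, hcont, -⟩ := strictAntiOn_logThroughput (hk₀.trans hk) hkn
  have hup : logThroughput n k₀ p₀ (otherValue n k₀ p₀) ≤
      logThroughput n k p₀ (otherValue n k p₀) :=
    (strictMonoOn_logThroughput hp₀).monotoneOn ⟨hk₀, hk.trans hkn⟩ ⟨hk₀.trans hk, hkn⟩ hk
  have hend : logThroughput n k (1 / n) (otherValue n k (1 / n)) <
      logThroughput n k₀ p₀ (otherValue n k₀ p₀) := by
    have h1 := (strictAntiOn_logThroughput hk₀ (hk.trans hkn)).1 ⟨hp₀.1, hp₀.2.le⟩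
      (right_mem_Ioc.mpr (one_div_pos.mpr hn)) hp₀.2
    refine lt_of_eq_of_lt ?_ h1
    simp only
    rw [otherValue_one_div hn.ne' (by linarith), otherValue_one_div hn.ne' (by linarith)]
    unfold logThroughput oddsSum
    congr 1
    · ring
    · congr 1; ring
  obtain ⟨p, hp, hpe⟩ := intermediate_value_Icc' hp₀.2.le
    (hcont.mono fun x hx => ⟨hp₀.1.trans_le hx.1, hx.2⟩) ⟨hend.le, hup⟩
  refine ⟨p, ⟨hp₀.1.trans_le hp.1, hp.2.lt_of_ne ?_⟩, hpe⟩
  rintro rfl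
  exact hend.ne hpe

theorem fairObjective_lt_of_logThroughput_eq {α θ n k₀ k₁ p₀ p₁ : ℝ} (hα : 1 ≤ α) (hθ : 0 < θ)
    (hk₀ : 1 ≤ k₀) (hk : k₀ < k₁) (hk₁ : k₁ ≤ n - 1)
    (hp₀ : p₀ ∈ Ioo 0 (1 / n)) (hp₁ : p₁ ∈ Ioo 0 (1 / n))
    (hT : logThroughput n k₀ p₀ (otherValue n k₀ p₀) =
      logThroughput n k₁ p₁ (otherValue n k₁ p₁)) :
    fairObjective α θ n k₀ p₀ (otherValue n k₀ p₀) <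
      fairObjective α θ n k₁ p₁ (otherValue n k₁ p₁) := by
  have hex : ∀ k, k ∈ Icc k₀ k₁ → ∃ p, p ∈ Ioo 0 (1 / n) ∧
      logThroughput n k p (otherValue n k p) = logThroughput n k₀ p₀ (otherValue n k₀ p₀) :=
    fun k hk => by
      obtain ⟨p, hp⟩ := exists_logThroughput_eq hk₀ hk.1 (hk.2.trans hk₁) hp₀
      exact ⟨p, hp⟩
  have huniq : ∀ k ∈ Icc k₀ k₁, ∀ p ∈ Ioo 0 (1 / n), ∀ q ∈ Ioo 0 (1 / n),
      logThroughput n k p (otherValue n k p) = logThroughput n k q (otherValue n k q) →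
      p = q := fun k hk p hp q hq h =>
    (strictAntiOn_logThroughput (hk₀.trans hk.1) (hk.2.trans hk₁)).1.injOn
      (Ioo_subset_Ioc_self hp) (Ioo_subset_Ioc_self hq) h
  choose! P hP using hex
  have hl : k₀ ∈ Icc k₀ k₁ := left_mem_Icc.mpr hk.le
  have hr : k₁ ∈ Icc k₀ k₁ := right_mem_Icc.mpr hk.le
  have hP0 : P k₀ = p₀ := huniq k₀ hl _ (hP k₀ hl).1 _ hp₀ (hP k₀ hl).2
  have hP1 : P k₁ = p₁ := huniq k₁ hr _ (hP k₁ hr).1 _ hp₁ ((hP k₁ hr).2.trans hT)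
  have hD : ∀ t ∈ Icc k₀ k₁, ∃ d > 0, HasDerivWithinAt
      (fun s => fairObjective α θ n s (P s) (otherValue n s (P s))) d (Icc k₀ k₁) t := by
    intro t ht
    have ht1 : 1 ≤ t := hk₀.trans ht.1
    have htn : t ≤ n - 1 := ht.2.trans hk₁
    obtain ⟨hPt, hPe⟩ := hP t ht
    have h := isTwoValued_otherValue ht1 htn hPt
    obtain ⟨d, hd0, hd⟩ := (strictAntiOn_logThroughput ht1 htn).2.2 _ hPt
    obtain ⟨ψ, ψ', hψ, hψt, hψe⟩ :=
      exists_hasDerivAt_level_curve (contDiffAt_logThroughput h) hd hd0.ne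
    have hnt : n - t ≠ 0 := by linarith
    have hb := otherValue.hasDerivAt (n := n) (hasDerivAt_id t) hψ hnt
    have hsum : HasDerivAt (fun s => id s * ψ s + (n - id s) * otherValue n s (ψ s)) 0 t := by
      refine (hasDerivAt_const t (1 : ℝ)).congr_of_eventuallyEq ?_
      filter_upwards [Iio_mem_nhds (show t < n by linarith)] with s hs
      have : n - s ≠ 0 := (sub_pos.mpr hs).ne'
      simp only [id, otherValue]
      field_simp
      ring
    have hTt : HasDerivAt (fun s => logThroughput n (id s) (ψ s) (otherValue n s (ψ s))) 0 t :=
      (hasDerivAt_const t _).congr_of_eventuallyEq hψe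
    obtain ⟨e, he0, he⟩ := exists_pos_hasDerivAt_fairObjective hα hθ (hasDerivAt_id t) hψ hb
      (by simpa only [id, hψt] using h) hsum hTt
    refine ⟨e, he0, he.hasDerivWithinAt.congr_of_eventuallyEq_of_mem ?_ ht⟩
    have hmem : ∀ᶠ s in 𝓝 t, ψ s ∈ Ioo 0 (1 / n) :=
      hψ.continuousAt.eventually_mem (Ioo_mem_nhds (by rw [hψt]; exact hPt.1)
        (by rw [hψt]; exact hPt.2))
    filter_upwards [nhdsWithin_le_nhds hψe, nhdsWithin_le_nhds hmem, self_mem_nhdsWithin]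
      with s hs1 hs2 hs3
    have : P s = ψ s :=
      huniq s hs3 _ (hP s hs3).1 _ hs2 ((hP s hs3).2.trans (hPe.symm.trans hs1.symm))
    simp only [this, id]
  have hmono := strictMonoOn_of_deriv_pos (convex_Icc k₀ k₁)
    (f := fun s => fairObjective α θ n s (P s) (otherValue n s (P s)))
    (fun t ht => by
      obtain ⟨d, -, hd⟩ := hD t ht
      exact hd.continuousWithinAt)
    (fun t ht => by
      obtain ⟨d, hd0, hd⟩ := hD t (interior_subset ht)
      rw [interior_Icc] at ht
      rwa [(hd.hasDerivAt (Icc_mem_nhds ht.1 ht.2)).deriv])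
  have := hmono hl hr hk
  simpa only [hP0, hP1] using this

section Bridge

variable {k n' : ℕ} {p : ℝ}

theorem plv_eq_otherValue : plv p k n' = otherValue n' k p := rfl

variable (hk : 1 ≤ k) (hkn : k ≤ n' - 1) (hp : p ∈ Ioo (0 : ℝ) (1 / (n' : ℝ)))

include hk hkn

theorem cast_mem_Icc_one_sub_one : (k : ℝ) ∈ Icc 1 ((n' : ℝ) - 1) := by
  have h : k + 1 ≤ n' := by omega
  have h' : (k : ℝ) + 1 ≤ n' := by exact_mod_cast h
  exact ⟨by exact_mod_cast hk, by linarith⟩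

include hp

theorem isTwoValued_cast : IsTwoValued n' k p (otherValue n' k p) :=
  have h := cast_mem_Icc_one_sub_one hk hkn
  isTwoValued_otherValue h.1 h.2 hp

theorem xsv_eq : xsv p k n' =
    (1 - p) ^ k * (1 - otherValue n' k p) ^ (n' - k) * odds p := by
  have h := isTwoValued_cast hk hkn hp
  have h1 : (1 : ℝ) - p ≠ 0 := by linarith [h.left_lt_one]
  obtain ⟨j, rfl⟩ : ∃ j, k = j + 1 := ⟨k - 1, by omega⟩
  unfold xsv odds
  rw [plv_eq_otherValue, Nat.add_sub_cancel, pow_succ]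
  field_simp

theorem xlv_eq : xlv p k n' =
    (1 - p) ^ k * (1 - otherValue n' k p) ^ (n' - k) * odds (otherValue n' k p) := by
  have h := isTwoValued_cast hk hkn hp
  have h1 : (1 : ℝ) - otherValue n' k p ≠ 0 := by linarith [h.lt_one]
  obtain ⟨j, hj⟩ : ∃ j, n' - k = j + 1 := ⟨n' - k - 1, by omega⟩
  unfold xlv odds
  rw [plv_eq_otherValue, hj, Nat.add_sub_cancel, pow_succ]
  field_simp

theorem Tp_eq : Tp p k n' =
    (1 - p) ^ k * (1 - otherValue n' k p) ^ (n' - k) * oddsSum n' k p (otherValue n' k p) := by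
  unfold Tp oddsSum
  rw [xsv_eq hk hkn hp, xlv_eq hk hkn hp]
  ring

theorem log_Tp : Real.log (Tp p k n') = logThroughput n' k p (otherValue n' k p) := by
  have h := isTwoValued_cast hk hkn hp
  have h1 : (1 : ℝ) - p ≠ 0 := by linarith [h.left_lt_one]
  have h2 : (1 : ℝ) - otherValue n' k p ≠ 0 := by linarith [h.lt_one]
  rw [Tp_eq hk hkn hp, Real.log_mul (mul_ne_zero (pow_ne_zero _ h1) (pow_ne_zero _ h2))
    h.oddsSum_pos.ne', Real.log_mul (pow_ne_zero _ h1) (pow_ne_zero _ h2), Real.log_pow,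
    Real.log_pow, Nat.cast_sub (by omega)]
  rfl

theorem FalphaP_eq_fairObjective (α : ℝ) :
    FalphaP α p k n' = fairObjective α (Tp p k n') n' k p (otherValue n' k p) := by
  have h := isTwoValued_cast hk hkn hp
  unfold FalphaP fairObjective
  rw [Tp_eq hk hkn hp, mul_div_cancel_right₀ _ h.oddsSum_pos.ne', xsv_eq hk hkn hp,
    xlv_eq hk hkn hp]

end Bridge

/-- Among two-valued controls of equal throughput, the `α`-fair objective is strictly increasing
in the number of small components. -/
theorem FalphaP_lt_of_Tp_eq {α θ : ℝ} (hα : 1 ≤ α) (hθ : 0 < θ) {n' k j : ℕ} (hk : 1 ≤ k)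
    (hkj : k < j) (hj : j ≤ n' - 1) {p q : ℝ} (hp : p ∈ Ioo (0 : ℝ) (1 / (n' : ℝ)))
    (hq : q ∈ Ioo (0 : ℝ) (1 / (n' : ℝ))) (hTp : Tp p k n' = θ) (hTq : Tp q j n' = θ) :
    FalphaP α p k n' < FalphaP α q j n' := by
  have hk' : k ≤ n' - 1 := by omega
  have hj' : 1 ≤ j := by omega
  rw [FalphaP_eq_fairObjective hk hk' hp, FalphaP_eq_fairObjective hj' hj hq, hTp, hTq]
  refine fairObjective_lt_of_logThroughput_eq hα hθ (cast_mem_Icc_one_sub_one hk hk').1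
    (by exact_mod_cast hkj) (cast_mem_Icc_one_sub_one hj' hj).2 hp hq ?_
  rw [← log_Tp hk hk' hp, ← log_Tp hj' hj hq, hTp, hTq]

theorem eq_of_Tp_eq {n' k : ℕ} (hk : 1 ≤ k) (hkn : k ≤ n' - 1) {p q : ℝ}
    (hp : p ∈ Ioo (0 : ℝ) (1 / (n' : ℝ))) (hq : q ∈ Ioo (0 : ℝ) (1 / (n' : ℝ)))
    (h : Tp p k n' = Tp q k n') : p = q := by
  have hI := cast_mem_Icc_one_sub_one hk hkn
  refine (strictAntiOn_logThroughput hI.1 hI.2).1.injOn (Ioo_subset_Ioc_self hp)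
    (Ioo_subset_Ioc_self hq) ?_
  rw [← log_Tp hk hkn hp, ← log_Tp hk hkn hq, h]

theorem alpha_fair_objective_increasing_in_k
    (α : ℝ) (hα : 1 ≤ α) (θ : ℝ) (hθ : θ ∈ Set.Ioo (0:ℝ) 1)
    (n' : ℕ) (hn' : 3 ≤ n') :
    (∀ k : ℕ, 1 ≤ k → k ≤ n' - 2 →
      ∀ ps ∈ Set.Ioo (0:ℝ) (1 / (n' : ℝ)), ∀ ps' ∈ Set.Ioo (0:ℝ) (1 / (n' : ℝ)),
        Tp ps k n' = θ → Tp ps' (k+1) n' = θ →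
        FalphaP α ps k n' < FalphaP α ps' (k+1) n') ∧
    -- in particular, the α-fair objective is maximized at k = n' - 1
    (∀ k : ℕ, 1 ≤ k → k ≤ n' - 1 →
      ∀ ps ∈ Set.Ioo (0:ℝ) (1 / (n' : ℝ)), ∀ psm ∈ Set.Ioo (0:ℝ) (1 / (n' : ℝ)),
        Tp ps k n' = θ → Tp psm (n'-1) n' = θ →
        FalphaP α ps k n' ≤ FalphaP α psm (n'-1) n') := by
  refine ⟨fun k hk hkn p hp q hq hTp hTq =>
    FalphaP_lt_of_Tp_eq hα hθ.1 hk k.lt_succ_self (by omega) hp hq hTp hTq,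
    fun k hk hkn p hp q hq hTp hTq => ?_⟩
  rcases hkn.eq_or_lt with rfl | hlt
  · rw [eq_of_Tp_eq hk le_rfl hp hq (hTp.trans hTq.symm)]
  · exact (FalphaP_lt_of_Tp_eq hα hθ.1 hk hlt le_rfl hp hq hTp hTq).le
end

section
/- (Theorem 1, regime 1: maximum Jain fairness below the critical throughput.) Let n ≥ 2 and θ ∈ (0, θ_n], where θ_n = (1 − 1/n)^{n−1}. Then there exists p̄ ∈ (0, 1/n] with p̄·(1−p̄)^{n−1} = θ/n; the uniform control p* with all n components equal to p̄ satisfies T(x(p*)) = θ and F_J(x(p*)) = 1; and F_J(x(p)) ≤ 1 for every p ∈ [0,1)^n with T(x(p)) = θ. Hence the maximum Jain fairness subject to throughput θ equals 1, achieved when every user receives rate θ/n. -/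
open scoped BigOperators

/-- The worst-case service rate of user `i` under control `p`. -/
noncomputable def rate {n : ℕ} (p : Fin n → ℝ) (i : Fin n) : ℝ :=
  p i * ∏ j ∈ Finset.univ.erase i, (1 - p j)

/-- The throughput of the rate vector of control `p`. -/
noncomputable def tput {n : ℕ} (p : Fin n → ℝ) : ℝ := ∑ i, rate p i

/-- Jain's fairness of a vector `x ∈ ℝ^n`. -/
noncomputable def jain {n : ℕ} (x : Fin n → ℝ) : ℝ :=
  (∑ i, x i) ^ 2 / ((n : ℝ) * ∑ i, (x i) ^ 2)

/-- The critical throughput `θ_t = (1 - 1/t)^(t-1)`. -/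
noncomputable def crit (t : ℕ) : ℝ := (1 - 1 / (t : ℝ)) ^ (t - 1)

/-- Jain's fairness never exceeds one. -/
theorem jain_le_one {n : ℕ} (x : Fin n → ℝ) : jain x ≤ 1 := by
  refine div_le_one_of_le₀ ?_ (by positivity)
  simpa using sq_sum_le_card_mul_sum_sq (s := Finset.univ) (f := x)

/-- A nonzero constant vector is perfectly fair. -/
theorem jain_const {n : ℕ} (hn : n ≠ 0) {c : ℝ} (hc : c ≠ 0) :
    jain (fun _ : Fin n => c) = 1 := by
  have hn' : (n : ℝ) ≠ 0 := Nat.cast_ne_zero.mpr hn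
  simp only [jain, Finset.sum_const, Finset.card_univ, Fintype.card_fin, nsmul_eq_mul]
  field_simp

/-- The rates of a uniform control. -/
theorem rate_const {n : ℕ} (q : ℝ) (i : Fin n) :
    rate (fun _ : Fin n => q) i = q * (1 - q) ^ (n - 1) := by
  simp [rate, Finset.card_erase_of_mem]

/-- Every throughput up to the critical one is attained by a uniform control. -/
theorem exists_uniform_control {n : ℕ} (hn : n ≠ 0) {θ : ℝ} (hθ0 : 0 < θ) (hθn : θ ≤ crit n) :
    ∃ q ∈ Set.Ioc (0 : ℝ) (1 / (n : ℝ)), q * (1 - q) ^ (n - 1) = θ / n := by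
  have hn' : (0 : ℝ) < n := Nat.cast_pos.mpr (Nat.pos_of_ne_zero hn)
  have hcont : ContinuousOn (fun q : ℝ => q * (1 - q) ^ (n - 1)) (Set.Icc 0 (1 / (n : ℝ))) := by
    fun_prop
  have hmem : θ / n ∈ Set.Ioc ((0 : ℝ) * (1 - 0) ^ (n - 1))
      (1 / (n : ℝ) * (1 - 1 / (n : ℝ)) ^ (n - 1)) := by
    refine ⟨by rw [zero_mul]; positivity, ?_⟩
    rw [div_eq_mul_one_div, mul_comm]
    exact mul_le_mul_of_nonneg_left hθn (by positivity)
  exact intermediate_value_Ioc (by positivity) hcont hmem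

theorem jain_regime_one (n : ℕ) (hn : 2 ≤ n) (θ : ℝ) (hθ0 : 0 < θ)
    (hθn : θ ≤ crit n) :
    ∃ pbar : ℝ, pbar ∈ Set.Ioc (0:ℝ) (1 / (n : ℝ)) ∧
      pbar * (1 - pbar) ^ (n - 1) = θ / n ∧
      tput (fun _ : Fin n => pbar) = θ ∧
      (∀ i : Fin n, rate (fun _ : Fin n => pbar) i = θ / n) ∧
      jain (fun i => rate (fun _ : Fin n => pbar) i) = 1 ∧
      ∀ p : Fin n → ℝ, (∀ i, p i ∈ Set.Ico (0:ℝ) 1) → tput p = θ →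
        jain (fun i => rate p i) ≤ 1 := by
  have hn0 : n ≠ 0 := by omega
  have hn' : (n : ℝ) ≠ 0 := Nat.cast_ne_zero.mpr hn0
  obtain ⟨q, hq, hqθ⟩ := exists_uniform_control hn0 hθ0 hθn
  have hrate (i : Fin n) : rate (fun _ : Fin n => q) i = θ / n := (rate_const q i).trans hqθ
  refine ⟨q, hq, hqθ, ?_, hrate, ?_, fun p _ _ => jain_le_one _⟩
  · simp only [tput, hrate, Finset.sum_const, Finset.card_univ, Fintype.card_fin, nsmul_eq_mul]
    exact mul_div_cancel₀ θ hn'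
  · simp only [hrate]
    exact jain_const hn0 (div_ne_zero hθ0.ne' hn')
end

section
/- (Theorem 2: the Jain tradeoff is unchanged under a throughput inequality constraint.) Let n ≥ 2 and θ ∈ (0,1). Then sup{ F_J(x(p)) : p ∈ [0,1)^n, T(x(p)) ≥ θ } = sup{ F_J(x(p)) : p ∈ [0,1)^n, T(x(p)) = θ }. -/
open scoped BigOperators

/-- Jain's fairness is invariant under scaling by a nonzero constant. -/
theorem jain_const_mul {n : ℕ} {c : ℝ} (hc : c ≠ 0) (x : Fin n → ℝ) :
    jain (fun i => c * x i) = jain x := by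
  have hc2 : c ^ 2 ≠ 0 := pow_ne_zero 2 hc
  simp only [jain, mul_pow, ← Finset.mul_sum]
  rw [mul_left_comm, mul_div_mul_left _ _ hc2]

/-- Multiplying every odds ratio `p i / (1 - p i)` by `t` rescales the rate vector. -/
theorem rate_scaled_odds {n : ℕ} (p : Fin n → ℝ) (t : ℝ) (h : ∀ i, 1 - p i + t * p i ≠ 0)
    (i : Fin n) :
    rate (fun j => t * p j / (1 - p j + t * p j)) i =
      t / (∏ j, (1 - p j + t * p j)) * rate p i := by
  have h1 : ∀ j, 1 - t * p j / (1 - p j + t * p j) = (1 - p j) / (1 - p j + t * p j) := by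
    intro j
    rw [eq_div_iff (h j), sub_mul, div_mul_cancel₀ _ (h j)]
    ring
  have h2 : ∏ j ∈ Finset.univ.erase i, (1 - p j + t * p j) ≠ 0 :=
    Finset.prod_ne_zero_iff.2 fun j _ => h j
  have h3 := h i
  simp only [rate, h1, Finset.prod_div_distrib]
  rw [← Finset.mul_prod_erase Finset.univ (fun j => 1 - p j + t * p j) (Finset.mem_univ i)]
  field_simp

/-- Any control can be modified so as to scale its rate vector by a given `c ∈ [0, 1]`. -/
theorem exists_rate_eq_const_mul {n : ℕ} (p : Fin n → ℝ) (hp : ∀ i, p i ∈ Set.Ico (0 : ℝ) 1)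
    {c : ℝ} (hc : c ∈ Set.Icc (0 : ℝ) 1) :
    ∃ q : Fin n → ℝ, (∀ i, q i ∈ Set.Ico (0 : ℝ) 1) ∧ ∀ i, rate q i = c * rate p i := by
  have hpos : ∀ t ∈ Set.Icc (0 : ℝ) 1, ∀ i, 0 < 1 - p i + t * p i := fun t ht i =>
    add_pos_of_pos_of_nonneg (sub_pos.2 (hp i).2) (mul_nonneg ht.1 (hp i).1)
  have hcont : ContinuousOn (fun t : ℝ => t / ∏ j, (1 - p j + t * p j)) (Set.Icc 0 1) :=
    continuousOn_id.div (by fun_prop) fun t ht => (Finset.prod_pos fun j _ => hpos t ht j).ne'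
  obtain ⟨t, ht, hct⟩ := intermediate_value_Icc zero_le_one hcont (by simpa using hc)
  refine ⟨fun j => t * p j / (1 - p j + t * p j), fun i => ⟨?_, ?_⟩, fun i => ?_⟩
  · exact div_nonneg (mul_nonneg ht.1 (hp i).1) (hpos t ht i).le
  · rw [div_lt_one (hpos t ht i)]
    linarith [(hp i).2]
  · rw [rate_scaled_odds p t fun i => (hpos t ht i).ne']
    exact congrArg (· * rate p i) hct

theorem jain_tradeoff_inequality_constraint (n : ℕ) (hn : 2 ≤ n)
    (θ : ℝ) (hθ : θ ∈ Set.Ioo (0:ℝ) 1) :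
    sSup {v : ℝ | ∃ p : Fin n → ℝ, (∀ i, p i ∈ Set.Ico (0:ℝ) 1) ∧
        θ ≤ tput p ∧ v = jain (fun i => rate p i)} =
    sSup {v : ℝ | ∃ p : Fin n → ℝ, (∀ i, p i ∈ Set.Ico (0:ℝ) 1) ∧
        tput p = θ ∧ v = jain (fun i => rate p i)} := by
  congr 1
  ext v
  constructor
  · rintro ⟨p, hp, hT, rfl⟩
    have hTpos : 0 < tput p := hθ.1.trans_le hT
    obtain ⟨q, hq, hqr⟩ := exists_rate_eq_const_mul p hp
      ⟨(div_pos hθ.1 hTpos).le, (div_le_one hTpos).2 hT⟩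
    refine ⟨q, hq, ?_, ?_⟩
    · simp only [tput, hqr, ← Finset.mul_sum]
      exact div_mul_cancel₀ θ hTpos.ne'
    · simp only [hqr]
      exact (jain_const_mul (div_pos hθ.1 hTpos).ne' (rate p)).symm
  · rintro ⟨p, hp, hT, rfl⟩
    exact ⟨p, hp, hT.ge, rfl⟩
end

section
/- (Theorem 3, items 4 and 5: regularity of the Jain tradeoff curve.) Let n ≥ 2 and define F_J*(θ; n) = sup{ F_J(x(p)) : p ∈ [0,1)^n, T(x(p)) = θ }. Then the function θ ↦ F_J*(θ; n) is continuous on [θ_n, 1); it is strictly convex on each interval [θ_t, θ_{t−1}) for t ∈ {2,…,n}; and, if n ≥ 3, it is not differentiable at θ_t for each t ∈ {2,…,n−1}. -/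
open scoped BigOperators

/-- The optimized Jain fairness under the throughput equality constraint. -/
noncomputable def FJstar (n : ℕ) (θ : ℝ) : ℝ :=
  sSup {v : ℝ | ∃ p : Fin n → ℝ, (∀ i, p i ∈ Set.Ico (0:ℝ) 1) ∧
    tput p = θ ∧ v = jain (fun i => rate p i)}


/-! ### Reduction to two-level configurations -/

/-- Three distinct levels, the smallest positive, can be moved so that the sum and the sum of
squares stay fixed while the product decreases. -/
lemma exists_smaller_prod {x y z : ℝ} (hx : 0 < x) (hxy : x ≤ y) (hyz : y < z) :
    ∃ x' y' z' : ℝ, 0 ≤ x' ∧ 0 ≤ y' ∧ 0 ≤ z' ∧ x' + (y' + z') = x + (y + z) ∧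
      x' ^ 2 + (y' ^ 2 + z' ^ 2) = x ^ 2 + (y ^ 2 + z ^ 2) ∧
      (1 + x') * ((1 + y') * (1 + z')) < (1 + x) * ((1 + y) * (1 + z)) := by
  have hs : 0 < y + z := by linarith
  have hd : 0 < (z - y) ^ 2 := by have := sub_pos.2 hyz; positivity
  obtain ⟨e, he0, hex, hed⟩ : ∃ e : ℝ, 0 < e ∧ e ≤ x ∧ e * (5 * (y + z)) ≤ (z - y) ^ 2 := by
    refine ⟨min x ((z - y) ^ 2 / (5 * (y + z))), by positivity, min_le_left _ _, ?_⟩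
    rw [← le_div_iff₀ (by positivity)]
    exact min_le_right _ _
  set d : ℝ := (z - y) ^ 2 - e * (2 * (y + z) - 4 * x) - 3 * e ^ 2 with hdd
  have hd0 : 0 ≤ d := by
    nlinarith [mul_pos he0 hx, mul_pos he0 hs, mul_nonneg he0.le (sub_nonneg.2 hex),
      mul_nonneg he0.le (sub_nonneg.2 hxy)]
  have hsq := Real.sq_sqrt hd0
  have hle : √d ≤ y + z + e := by
    apply Real.sqrt_le_iff.2 ⟨by positivity, ?_⟩
    nlinarith [mul_pos he0 hx, mul_pos he0 hs, mul_pos (hx.trans_le hxy) (hx.trans_le (hxy.trans hyz.le)),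
      mul_nonneg he0.le (sub_nonneg.2 hxy)]
  have h0 := Real.sqrt_nonneg d
  refine ⟨x - e, (y + z + e - √d) / 2, (y + z + e + √d) / 2, by linarith, by linarith, by linarith,
    by ring, by nlinarith, ?_⟩
  have key : (1 + x) * ((1 + y) * (1 + z)) -
      (1 + (x - e)) * ((1 + (y + z + e - √d) / 2) * (1 + (y + z + e + √d) / 2)) =
      e * (y - x + e) * (z - x + e) + (1 + (x - e)) / 4 * (√d ^ 2 - d) := by
    rw [hdd]; ring
  have : 0 < e * (y - x + e) * (z - x + e) := by
    have h1 : 0 < y - x + e := by linarith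
    have h2 : 0 < z - x + e := by linarith
    positivity
  rw [hsq] at key
  linarith

lemma sum_eq_three {ι : Type*} [Fintype ι] [DecidableEq ι] {i j l : ι} (hij : i ≠ j) (hil : i ≠ l)
    (hjl : j ≠ l) (f : ι → ℝ) :
    ∑ x, f x = f i + (f j + f l) + ∑ x ∈ ((Finset.univ.erase i).erase j).erase l, f x := by
  rw [← Finset.add_sum_erase _ f (Finset.mem_univ i),
    ← Finset.add_sum_erase (Finset.univ.erase i) f (a := j) (by simp [hij.symm]),
    ← Finset.add_sum_erase ((Finset.univ.erase i).erase j) f (a := l) (by simp [hil.symm, hjl.symm])]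
  ring

lemma prod_eq_three {ι : Type*} [Fintype ι] [DecidableEq ι] {i j l : ι} (hij : i ≠ j) (hil : i ≠ l)
    (hjl : j ≠ l) (f : ι → ℝ) :
    ∏ x, f x = f i * (f j * f l) * ∏ x ∈ ((Finset.univ.erase i).erase j).erase l, f x := by
  rw [← Finset.mul_prod_erase _ f (Finset.mem_univ i),
    ← Finset.mul_prod_erase (Finset.univ.erase i) f (a := j) (by simp [hij.symm]),
    ← Finset.mul_prod_erase ((Finset.univ.erase i).erase j) f (a := l) (by simp [hil.symm, hjl.symm])]
  ring

/-- Minimizers of `∏ (1 + v i)` under fixed sum and sum of squares exist, and their two largest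
levels agree. -/
lemma exists_min_prod {ι : Type*} [Fintype ι] [DecidableEq ι] (u : ι → ℝ) (hu : ∀ i, 0 ≤ u i) :
    ∃ v : ι → ℝ, (∀ i, 0 ≤ v i) ∧ ∑ i, v i = ∑ i, u i ∧ ∑ i, v i ^ 2 = ∑ i, u i ^ 2 ∧
      ∏ i, (1 + v i) ≤ ∏ i, (1 + u i) ∧
      ∀ i j l, i ≠ j → i ≠ l → j ≠ l → 0 < v i → v i ≤ v j → v l ≤ v j := by
  let K : Set (ι → ℝ) := {v | (∀ i, 0 ≤ v i) ∧ ∑ i, v i = ∑ i, u i ∧ ∑ i, v i ^ 2 = ∑ i, u i ^ 2}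
  have hK : IsCompact K := by
    refine IsCompact.of_isClosed_subset
      (isCompact_Icc (a := fun _ : ι => (0 : ℝ)) (b := fun _ : ι => ∑ i, u i)) ?_ ?_
    · refine IsClosed.inter ?_ (IsClosed.inter ?_ ?_)
      · have : {v : ι → ℝ | ∀ i, 0 ≤ v i} = ⋂ i, {v | 0 ≤ v i} := by ext; simp
        change IsClosed {v : ι → ℝ | ∀ i, 0 ≤ v i}
        rw [this]
        exact isClosed_iInter fun i => isClosed_le continuous_const (continuous_apply i)
      · exact isClosed_eq (by fun_prop) continuous_const
      · exact isClosed_eq (by fun_prop) continuous_const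
    · rintro v ⟨h0, h1, -⟩
      refine ⟨fun i => h0 i, fun i => ?_⟩
      rw [← h1]
      exact Finset.single_le_sum (fun j _ => h0 j) (Finset.mem_univ i)
  obtain ⟨v, hv, hmin⟩ := hK.exists_isMinOn (f := fun v : ι → ℝ => ∏ i, (1 + v i))
    ⟨u, hu, rfl, rfl⟩ (by fun_prop)
  refine ⟨v, hv.1, hv.2.1, hv.2.2, hmin ⟨hu, rfl, rfl⟩, ?_⟩
  intro i j l hij hil hjl hi hle
  by_contra! hlt
  obtain ⟨x', y', z', hx', hy', hz', h1, h2, h3⟩ := exists_smaller_prod hi hle hlt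
  let w : ι → ℝ := fun a => if a = i then x' else if a = j then y' else if a = l then z' else v a
  have hwi : w i = x' := by simp [w]
  have hwj : w j = y' := by simp [w, hij.symm]
  have hwl : w l = z' := by simp [w, hil.symm, hjl.symm]
  have hwo : ∀ a ∈ ((Finset.univ.erase i).erase j).erase l, w a = v a := by
    intro a ha
    simp only [Finset.mem_erase, Finset.mem_univ, and_true] at ha
    simp [w, ha]
  have hw : w ∈ K := by
    refine ⟨fun a => ?_, ?_, ?_⟩
    · simp only [w]
      split_ifs <;> first | assumption | exact hv.1 a
    · rw [← hv.2.1, sum_eq_three hij hil hjl, sum_eq_three hij hil hjl v, Finset.sum_congr rfl hwo,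
        hwi, hwj, hwl, h1]
    · rw [← hv.2.2, sum_eq_three hij hil hjl, sum_eq_three hij hil hjl (fun a => v a ^ 2),
        Finset.sum_congr rfl (fun a ha => by rw [hwo a ha]), hwi, hwj, hwl, h2]
  have := hmin hw
  change ∏ a, (1 + v a) ≤ ∏ a, (1 + w a) at this
  rw [prod_eq_three hij hil hjl, prod_eq_three hij hil hjl (fun a => 1 + w a),
    Finset.prod_congr rfl (fun a ha => by rw [hwo a ha] : ∀ a ∈ _, 1 + w a = 1 + v a), hwi, hwj, hwl] at this
  have hpos : 0 < ∏ a ∈ ((Finset.univ.erase i).erase j).erase l, (1 + v a) :=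
    Finset.prod_pos fun a _ => by linarith [hv.1 a]
  exact absurd (le_of_mul_le_mul_right this hpos) (not_le.2 h3)

lemma sum_two_level {ι : Type*} [Fintype ι] [DecidableEq ι] {v : ι → ℝ} {A : Finset ι} {i₀ : ι} {a : ℝ}
    (hi : i₀ ∉ A) (hA : ∀ i ∈ A, v i = a) (h0 : ∀ i, i ≠ i₀ → i ∉ A → v i = 0)
    (f : ℝ → ℝ) (hf : f 0 = 0) : ∑ i, f (v i) = A.card * f a + f (v i₀) := by
  rw [← Finset.sum_subset (Finset.subset_univ (insert i₀ A)), Finset.sum_insert hi,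
    Finset.sum_congr rfl (fun i h => by rw [hA i h])]
  · simp [add_comm]
  · intro i _ h
    simp only [Finset.mem_insert, not_or] at h
    rw [h0 i h.1 h.2, hf]

lemma prod_two_level {ι : Type*} [Fintype ι] [DecidableEq ι] {v : ι → ℝ} {A : Finset ι} {i₀ : ι} {a : ℝ}
    (hi : i₀ ∉ A) (hA : ∀ i ∈ A, v i = a) (h0 : ∀ i, i ≠ i₀ → i ∉ A → v i = 0)
    (f : ℝ → ℝ) (hf : f 0 = 1) : ∏ i, f (v i) = f a ^ A.card * f (v i₀) := by
  rw [← Finset.prod_subset (Finset.subset_univ (insert i₀ A)), Finset.prod_insert hi,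
    Finset.prod_congr rfl (fun i h => by rw [hA i h])]
  · simp [mul_comm]
  · intro i _ h
    simp only [Finset.mem_insert, not_or] at h
    rw [h0 i h.1 h.2, hf]

lemma exists_two_level_le {n : ℕ} (hn : 2 ≤ n) (u : Fin n → ℝ) (hu : ∀ i, 0 ≤ u i)
    (hS : 0 < ∑ i, u i) :
    ∃ (k : ℕ) (a b : ℝ), 1 ≤ k ∧ k + 1 ≤ n ∧ 0 ≤ b ∧ b ≤ a ∧ k * a + b = ∑ i, u i ∧
      k * a ^ 2 + b ^ 2 = ∑ i, u i ^ 2 ∧ (1 + a) ^ k * (1 + b) ≤ ∏ i, (1 + u i) := by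
  obtain ⟨v, hv0, hv1, hv2, hvp, hv⟩ := exists_min_prod u hu
  have : Nonempty (Fin n) := ⟨⟨0, by omega⟩⟩
  obtain ⟨l, hl⟩ := Finite.exists_max v
  have hlpos : 0 < v l := by
    by_contra! h
    have : ∑ i, v i ≤ 0 := Finset.sum_nonpos fun i _ => (hl i).trans h
    linarith
  obtain ⟨i₀, hi₀l, hi₀⟩ : ∃ i₀, i₀ ≠ l ∧ ∀ j, j ≠ i₀ → v j ≠ v l → v j = 0 := by
    by_cases h : ∃ i, 0 < v i ∧ v i < v l
    · obtain ⟨i, h0, h1⟩ := h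
      have hil : i ≠ l := by rintro rfl; exact lt_irrefl _ h1
      refine ⟨i, hil, fun j hji hjl => ?_⟩
      by_contra hj
      have hj0 : 0 < v j := lt_of_le_of_ne (hv0 j) (Ne.symm hj)
      have hjl' : j ≠ l := by rintro rfl; exact hjl rfl
      rcases le_total (v i) (v j) with h2 | h2
      · exact hjl (le_antisymm (hl j) (hv i j l hji.symm hil hjl' h0 h2))
      · exact absurd (hv j i l hji hjl' hil hj0 h2) (not_le.2 h1)
    · push Not at h
      have : Nontrivial (Fin n) := Fin.nontrivial_iff_two_le.2 hn
      obtain ⟨i, hi⟩ := exists_ne l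
      refine ⟨i, hi, fun j _ hj => ?_⟩
      by_contra hj'
      exact hj (le_antisymm (hl j) (h j (lt_of_le_of_ne (hv0 j) (Ne.symm hj'))))
  let A : Finset (Fin n) := (Finset.univ.erase i₀).filter fun j => v j = v l
  have hiA : i₀ ∉ A := by simp [A]
  have hA : ∀ i ∈ A, v i = v l := fun i hi => (Finset.mem_filter.1 hi).2
  have h0 : ∀ i, i ≠ i₀ → i ∉ A → v i = 0 := by
    intro i h1 h2
    exact hi₀ i h1 (fun h => h2 (by simp [A, h1, h]))
  refine ⟨A.card, v l, v i₀, ?_, ?_, hv0 _, hl _, ?_, ?_, ?_⟩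
  · exact Finset.card_pos.2 ⟨l, by simp [A, hi₀l.symm]⟩
  · have h1 : A.card ≤ (Finset.univ.erase i₀).card := Finset.card_filter_le _ _
    rw [Finset.card_erase_of_mem (Finset.mem_univ _), Finset.card_univ, Fintype.card_fin] at h1
    omega
  · rw [← hv1, sum_two_level hiA hA h0 (fun x => x) rfl]
  · rw [← hv2, sum_two_level hiA hA h0 (fun x => x ^ 2) (by norm_num)]
  · rwa [← prod_two_level hiA hA h0 (fun x => 1 + x) (by norm_num)]

/-! ### The two-level family -/

/-- Throughput of `k` users of odds `S (1 + d) / (k + 1)` and one user of odds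
`S (1 - k d) / (k + 1)`. -/
noncomputable def levelT (k : ℕ) (S d : ℝ) : ℝ :=
  S / ((1 + S * (1 + d) / (k + 1)) ^ k * (1 + S * (1 - k * d) / (k + 1)))

/-- The gap `d` belonging to the configuration with `k` users of control `(1 + z) / (k + 1)` and
one user of control `(1 - k z) / (k + 1)`. -/
noncomputable def gap (k : ℕ) (z : ℝ) : ℝ := (k + 1) * z / (k + (k - 1) * z + k * z ^ 2)

/-- The throughput of the configuration with `k` users of control `(1 + z) / (k + 1)` and
one user of control `(1 - k z) / (k + 1)`. -/
noncomputable def optT (k : ℕ) (z : ℝ) : ℝ :=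
  (k + (k - 1) * z + k * z ^ 2) / (k + 1) * ((k - z) / (k + 1)) ^ (k - 1)

/-- The inverse participation ratio of a two-level configuration of gap `d`. -/
noncomputable def ipr (k : ℕ) (d : ℝ) : ℝ := (k + 1) / (1 + k * d ^ 2)

lemma gap_denom_pos {k : ℕ} (hk : 1 ≤ k) {z : ℝ} (hz : 0 ≤ z) :
    0 < (k : ℝ) + (k - 1) * z + k * z ^ 2 := by
  have h : (1 : ℝ) ≤ k := by exact_mod_cast hk
  have := mul_nonneg (sub_nonneg.2 h) hz
  positivity

lemma lt_of_mem_Icc_inv {k : ℕ} (hk : 1 ≤ k) {z : ℝ} (hz : z ∈ Set.Icc 0 (1 / (k : ℝ))) :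
    z ≤ 1 ∧ k * z ≤ 1 := by
  have h : (1 : ℝ) ≤ k := by exact_mod_cast hk
  have h2 : k * z ≤ 1 := by
    have := hz.2
    rw [le_div_iff₀ (by positivity)] at this
    linarith
  exact ⟨by nlinarith [hz.1], h2⟩

lemma gap_zero (k : ℕ) : gap k 0 = 0 := by simp [gap]

lemma gap_inv {k : ℕ} (hk : 1 ≤ k) : gap k (1 / k) = 1 / k := by
  have h : (0 : ℝ) < k := by exact_mod_cast hk
  unfold gap
  field_simp
  ring_nf
  field_simp

lemma gap_strictMonoOn {k : ℕ} (hk : 1 ≤ k) : StrictMonoOn (gap k) (Set.Icc 0 (1 / (k : ℝ))) := by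
  intro x hx y hy hxy
  have h : (1 : ℝ) ≤ k := by exact_mod_cast hk
  unfold gap
  rw [div_lt_div_iff₀ (gap_denom_pos hk hx.1) (gap_denom_pos hk hy.1)]
  have h1 := (lt_of_mem_Icc_inv hk hy).1
  have hxy1 : x * y < 1 := by nlinarith [hx.1]
  have : 0 < (k + 1) * (k * ((y - x) * (1 - x * y))) := by
    have := sub_pos.2 hxy
    have := sub_pos.2 hxy1
    positivity
  nlinarith

lemma gap_continuousOn {k : ℕ} (hk : 1 ≤ k) : ContinuousOn (gap k) (Set.Icc 0 (1 / (k : ℝ))) := by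
  unfold gap
  exact ContinuousOn.div (by fun_prop) (by fun_prop) fun z hz => (gap_denom_pos hk hz.1).ne'

lemma gap_mem {k : ℕ} (hk : 1 ≤ k) {z : ℝ} (hz : z ∈ Set.Icc 0 (1 / (k : ℝ))) :
    gap k z ∈ Set.Icc 0 (1 / (k : ℝ)) := by
  have h : (0 : ℝ) ≤ 1 / k := by positivity
  constructor
  · rw [← gap_zero k]
    exact (gap_strictMonoOn hk).monotoneOn ⟨le_rfl, h⟩ hz hz.1
  · rw [← gap_inv hk]
    exact (gap_strictMonoOn hk).monotoneOn hz ⟨h, le_rfl⟩ hz.2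

lemma exists_gap_eq {k : ℕ} (hk : 1 ≤ k) {d : ℝ} (hd : d ∈ Set.Icc 0 (1 / (k : ℝ))) :
    ∃ z ∈ Set.Icc 0 (1 / (k : ℝ)), gap k z = d := by
  have h : (0 : ℝ) ≤ 1 / k := by positivity
  have := intermediate_value_Icc h (gap_continuousOn hk)
  rw [gap_zero, gap_inv hk] at this
  exact this hd

/-- The total odds of the two-level configuration with parameter `z`. -/
noncomputable def optS (k : ℕ) (z : ℝ) : ℝ :=
  (k + 1) * (k + (k - 1) * z + k * z ^ 2) / (k * (1 + z) * (k - z))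

lemma optS_pos {k : ℕ} (hk : 1 ≤ k) {z : ℝ} (hz : z ∈ Set.Icc 0 (1 / (k : ℝ))) (hz1 : z < 1) :
    0 < optS k z := by
  have h : (1 : ℝ) ≤ k := by exact_mod_cast hk
  have h1 := gap_denom_pos hk hz.1
  have h2 : 0 < k - z := by linarith
  have h3 := hz.1
  unfold optS
  positivity

lemma optS_high {k : ℕ} (hk : 1 ≤ k) {z : ℝ} (hz : z ∈ Set.Icc 0 (1 / (k : ℝ))) (hz1 : z < 1) :
    optS k z * (1 + gap k z) / (k + 1) = (1 + z) / (k - z) := by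
  have h : (1 : ℝ) ≤ k := by exact_mod_cast hk
  have h1 := gap_denom_pos hk hz.1
  have h2 : 0 < k - z := by linarith
  have h3 : 0 < 1 + z := by linarith [hz.1]
  unfold optS gap
  field_simp
  ring

lemma optS_low {k : ℕ} (hk : 1 ≤ k) {z : ℝ} (hz : z ∈ Set.Icc 0 (1 / (k : ℝ))) (hz1 : z < 1) :
    optS k z * (1 - k * gap k z) / (k + 1) = (1 - k * z) / (k * (1 + z)) := by
  have h : (1 : ℝ) ≤ k := by exact_mod_cast hk
  have h1 := gap_denom_pos hk hz.1
  have h2 : 0 < k - z := by linarith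
  have h3 : 0 < 1 + z := by linarith [hz.1]
  unfold optS gap
  field_simp
  ring

lemma levelT_optS {k : ℕ} (hk : 1 ≤ k) {z : ℝ} (hz : z ∈ Set.Icc 0 (1 / (k : ℝ))) (hz1 : z < 1) :
    levelT k (optS k z) (gap k z) = optT k z := by
  have h : (1 : ℝ) ≤ k := by exact_mod_cast hk
  have h1 := gap_denom_pos hk hz.1
  have h2 : 0 < k - z := by linarith
  have h3 : 0 < 1 + z := by linarith [hz.1]
  unfold levelT
  rw [optS_high hk hz hz1, optS_low hk hz hz1]
  have e1 : 1 + (1 + z) / (k - z) = ((k : ℝ) + 1) / (k - z) := by field_simp; ring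
  have e2 : 1 + (1 - k * z) / (k * (1 + z)) = ((k : ℝ) + 1) / (k * (1 + z)) := by field_simp; ring
  rw [e1, e2]
  unfold optS optT
  obtain ⟨j, rfl⟩ : ∃ j, k = j + 1 := ⟨k - 1, by omega⟩
  rw [Nat.add_sub_cancel, div_pow, div_pow]
  field_simp
  ring

lemma one_le_level {k : ℕ} {S d : ℝ} (hk : 1 ≤ k) (hS : 0 < S) (hd : d ∈ Set.Icc 0 (1 / (k : ℝ))) :
    1 < 1 + S * (1 + d) / (k + 1) ∧ 1 ≤ 1 + S * (1 - k * d) / (k + 1) := by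
  have h0 := hd.1
  have h1 := sub_nonneg.2 (lt_of_mem_Icc_inv hk hd).2
  constructor
  · have : 0 < S * (1 + d) / (k + 1) := by positivity
    linarith
  · have : 0 ≤ S * (1 - k * d) / (k + 1) := by positivity
    linarith

lemma levelT_le_optT {k : ℕ} (hk : 1 ≤ k) {z : ℝ} (hz : z ∈ Set.Icc 0 (1 / (k : ℝ))) {S : ℝ}
    (hS : 0 < S) : levelT k S (gap k z) ≤ optT k z := by
  have h : (1 : ℝ) ≤ k := by exact_mod_cast hk
  obtain ⟨hz1', hkz⟩ := lt_of_mem_Icc_inv hk hz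
  rcases hz1'.lt_or_eq with hz1 | rfl
  · rw [← levelT_optS hk hz hz1]
    have hS0 := optS_pos hk hz hz1
    have h1 := one_le_level hk hS (gap_mem hk hz)
    have h2 := one_le_level hk hS0 (gap_mem hk hz)
    set l := S / optS k z with hl
    have hl0 : 0 < l := by positivity
    have hSl : S = l * optS k z := by rw [hl]; field_simp
    have hz0 := hz.1
    set p : ℝ := (1 + z) / (k + 1) with hp
    set q : ℝ := (1 - k * z) / (k + 1) with hq
    have hp0 : 0 ≤ p := by positivity
    have hq0 : 0 ≤ q := div_nonneg (by linarith) (by positivity)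
    have hpq : p * k + q = 1 := by rw [hp, hq]; field_simp; ring
    have hp1 : p ≤ 1 := by nlinarith
    have hq1 : q ≤ 1 := by nlinarith
    have hkz' : 0 < k - z := by linarith
    have hA : 1 + S * (1 + gap k z) / (k + 1) =
        (p * l + (1 - p) * 1) * (1 + optS k z * (1 + gap k z) / (k + 1)) := by
      rw [hSl, mul_assoc, mul_div_assoc, optS_high hk hz hz1, hp]
      field_simp; ring
    have hB : 1 + S * (1 - k * gap k z) / (k + 1) =
        (q * l + (1 - q) * 1) * (1 + optS k z * (1 - k * gap k z) / (k + 1)) := by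
      have h3 : 0 < 1 + z := by linarith [hz.1]
      rw [hSl, mul_assoc, mul_div_assoc, optS_low hk hz hz1, hq]
      field_simp; ring
    have gA : l ^ p ≤ p * l + (1 - p) * 1 := by
      simpa using Real.geom_mean_le_arith_mean2_weighted hp0 (sub_nonneg.2 hp1) hl0.le zero_le_one
        (by ring)
    have gB : l ^ q ≤ q * l + (1 - q) * 1 := by
      simpa using Real.geom_mean_le_arith_mean2_weighted hq0 (sub_nonneg.2 hq1) hl0.le zero_le_one
        (by ring)
    have hprod : l ≤ (p * l + (1 - p) * 1) ^ k * (q * l + (1 - q) * 1) := by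
      calc l = (l ^ p) ^ k * l ^ q := by
            rw [← Real.rpow_mul_natCast hl0.le, ← Real.rpow_add hl0, hpq, Real.rpow_one]
        _ ≤ _ := by gcongr
    unfold levelT
    rw [hA, hB, mul_pow]
    have p1 : 0 < 1 + optS k z * (1 + gap k z) / (k + 1) := by linarith
    have p2 : 0 < 1 + optS k z * (1 - k * gap k z) / (k + 1) := by linarith
    generalize 1 + optS k z * (1 + gap k z) / (k + 1) = X at *
    generalize 1 + optS k z * (1 - k * gap k z) / (k + 1) = Y at *
    have hM : 0 < (p * l + (1 - p) * 1) ^ k * (q * l + (1 - q) * 1) := hl0.trans_le hprod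
    rw [mul_mul_mul_comm, hSl, mul_div_mul_comm]
    have : 0 ≤ optS k z / (X ^ k * Y) := by positivity
    calc _ ≤ 1 * (optS k z / (X ^ k * Y)) := by
          gcongr
          exact (div_le_one hM).2 hprod
      _ = _ := one_mul _
  · obtain rfl : k = 1 := by
      have : (k : ℝ) ≤ 1 := by linarith
      exact le_antisymm (by exact_mod_cast this) hk
    have e : gap 1 1 = 1 := by simpa using gap_inv hk
    rw [e]
    simp only [levelT, optT]
    norm_num
    rw [div_le_one (by linarith)]
    linarith

/-- The derivative of the denominator of `levelT`. -/
lemma level_hasDerivAt {k : ℕ} (hk : 1 ≤ k) (S d : ℝ) :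
    HasDerivAt (fun d => (1 + S * (1 + d) / (k + 1)) ^ k * (1 + S * (1 - k * d) / (k + 1)))
      (-(k * S ^ 2 / (k + 1) * d * (1 + S * (1 + d) / (k + 1)) ^ (k - 1))) d := by
  have hA : HasDerivAt (fun d => 1 + S * (1 + d) / ((k : ℝ) + 1)) (S * 1 / (k + 1)) d :=
    ((((hasDerivAt_id d).const_add 1).const_mul S).div_const _).const_add 1
  have hB : HasDerivAt (fun d => 1 + S * (1 - k * d) / ((k : ℝ) + 1)) (S * (-(k * 1)) / (k + 1)) d :=
    (((((hasDerivAt_id d).const_mul (k : ℝ)).const_sub 1).const_mul S).div_const _).const_add 1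
  refine ((hA.pow k).mul hB).congr_deriv ?_
  obtain ⟨j, rfl⟩ : ∃ j, k = j + 1 := ⟨k - 1, by omega⟩
  simp only [Nat.add_sub_cancel, Pi.pow_apply]
  rw [pow_succ]
  push_cast
  field_simp
  ring

lemma level_strictAntiOn {k : ℕ} (hk : 1 ≤ k) {S : ℝ} (hS : 0 < S) :
    StrictAntiOn (fun d => (1 + S * (1 + d) / (k + 1)) ^ k * (1 + S * (1 - k * d) / (k + 1)))
      (Set.Icc 0 (1 / (k : ℝ))) := by
  refine strictAntiOn_of_deriv_neg (convex_Icc _ _) (by fun_prop) fun d hd => ?_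
  rw [interior_Icc] at hd
  rw [(level_hasDerivAt hk S d).deriv]
  have h0 : 0 < d := hd.1
  have : (0 : ℝ) < k := by exact_mod_cast hk
  rw [neg_lt_zero]
  positivity

lemma levelT_strictMonoOn {k : ℕ} (hk : 1 ≤ k) {S : ℝ} (hS : 0 < S) :
    StrictMonoOn (levelT k S) (Set.Icc 0 (1 / (k : ℝ))) := by
  intro x hx y hy hxy
  have h := level_strictAntiOn hk hS hx hy hxy
  have := one_le_level hk hS hy
  have p1 : 0 < 1 + S * (1 + y) / (k + 1) := by linarith
  have p2 : 0 < 1 + S * (1 - k * y) / (k + 1) := by linarith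
  exact div_lt_div_of_pos_left hS (by positivity) h

lemma optT_strictMonoOn {k : ℕ} (hk : 1 ≤ k) : StrictMonoOn (optT k) (Set.Icc 0 (1 / (k : ℝ))) := by
  intro x hx y hy hxy
  have hx1 : x < 1 := hxy.trans_le (lt_of_mem_Icc_inv hk hy).1
  rw [← levelT_optS hk hx hx1]
  have hS := optS_pos hk hx hx1
  exact (levelT_strictMonoOn hk hS (gap_mem hk hx) (gap_mem hk hy)
    (gap_strictMonoOn hk hx hy hxy)).trans_le (levelT_le_optT hk hy hS)

lemma optT_zero {k : ℕ} (hk : 1 ≤ k) : optT k 0 = crit (k + 1) := by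
  have h : (0 : ℝ) < k := by exact_mod_cast hk
  unfold optT crit
  obtain ⟨j, rfl⟩ : ∃ j, k = j + 1 := ⟨k - 1, by omega⟩
  simp only [Nat.add_sub_cancel]
  rw [pow_succ]
  have e : (1 - 1 / (((j + 1 + 1 : ℕ) : ℝ))) = (((j + 1 : ℕ) : ℝ) - 0) / (((j + 1 : ℕ) : ℝ) + 1) := by
    push_cast; field_simp; ring
  rw [e]
  ring

lemma optT_inv {k : ℕ} (hk : 1 ≤ k) : optT k (1 / k) = crit k := by
  have h : (0 : ℝ) < k := by exact_mod_cast hk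
  unfold optT crit
  have e1 : (k + (k - 1) * (1 / k) + k * (1 / k : ℝ) ^ 2) / (k + 1) = 1 := by field_simp; ring
  have e2 : (k - 1 / (k : ℝ)) / (k + 1) = 1 - 1 / k := by field_simp; ring
  rw [e1, e2, one_mul]

lemma crit_succ_lt {k : ℕ} (hk : 1 ≤ k) : crit (k + 1) < crit k := by
  have h : (0 : ℝ) < 1 / k := by have : (0 : ℝ) < k := by exact_mod_cast hk
                                 positivity
  rw [← optT_zero hk, ← optT_inv hk]
  exact optT_strictMonoOn hk ⟨le_rfl, h.le⟩ ⟨h.le, le_rfl⟩ h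

lemma crit_lt {j k : ℕ} (hj : 1 ≤ j) (hjk : j < k) : crit k < crit j := by
  induction k, hjk using Nat.le_induction with
  | base => exact crit_succ_lt hj
  | succ k hk ih => exact (crit_succ_lt (by omega)).trans ih

lemma optT_continuousOn (k : ℕ) (s : Set ℝ) : ContinuousOn (optT k) s := by
  unfold optT; fun_prop

lemma ipr_strictAntiOn {k : ℕ} (hk : 1 ≤ k) : StrictAntiOn (ipr k) (Set.Ici 0) := by
  intro x hx y _ hxy
  have h : (0 : ℝ) < k := by exact_mod_cast hk
  have hx : 0 ≤ x := hx
  unfold ipr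
  gcongr

lemma ipr_zero (k : ℕ) : ipr k 0 = k + 1 := by simp [ipr]

lemma ipr_inv {k : ℕ} (hk : 1 ≤ k) : ipr k (1 / k) = k := by
  have h : (0 : ℝ) < k := by exact_mod_cast hk
  unfold ipr
  field_simp

lemma ipr_gap_strictAntiOn {k : ℕ} (hk : 1 ≤ k) :
    StrictAntiOn (fun z => ipr k (gap k z)) (Set.Icc 0 (1 / (k : ℝ))) := fun _ hx _ hy hxy =>
  ipr_strictAntiOn hk (gap_mem hk hx).1 (gap_mem hk hy).1 (gap_strictMonoOn hk hx hy hxy)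

lemma ipr_gap_mem {k : ℕ} (hk : 1 ≤ k) {z : ℝ} (hz : z ∈ Set.Icc 0 (1 / (k : ℝ))) :
    (k : ℝ) ≤ ipr k (gap k z) ∧ ipr k (gap k z) ≤ k + 1 := by
  have h : (0 : ℝ) ≤ 1 / k := by positivity
  have hd := gap_mem hk hz
  constructor
  · have := (ipr_strictAntiOn hk).antitoneOn hd.1 h hd.2
    rwa [ipr_inv hk] at this
  · rw [← ipr_zero k]
    exact (ipr_strictAntiOn hk).antitoneOn (Set.mem_Ici.2 le_rfl) hd.1 hd.1

lemma optT_mem {k : ℕ} (hk : 1 ≤ k) {z : ℝ} (hz : z ∈ Set.Icc 0 (1 / (k : ℝ))) :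
    crit (k + 1) ≤ optT k z ∧ optT k z ≤ crit k := by
  have h : (0 : ℝ) ≤ 1 / k := by positivity
  rw [← optT_zero hk, ← optT_inv hk]
  exact ⟨(optT_strictMonoOn hk).monotoneOn ⟨le_rfl, h⟩ hz hz.1,
    (optT_strictMonoOn hk).monotoneOn hz ⟨h, le_rfl⟩ hz.2⟩

/-- Across all pieces of the curve, more throughput means less fairness. -/
lemma ipr_le_of_optT_le {j k : ℕ} (hj : 1 ≤ j) (hk : 1 ≤ k) {y z : ℝ}
    (hy : y ∈ Set.Icc 0 (1 / (j : ℝ))) (hz : z ∈ Set.Icc 0 (1 / (k : ℝ)))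
    (h : optT j y ≤ optT k z) : ipr k (gap k z) ≤ ipr j (gap j y) := by
  rcases lt_trichotomy k j with hkj | rfl | hkj
  · have : (k : ℝ) + 1 ≤ j := by exact_mod_cast hkj
    linarith [(ipr_gap_mem hk hz).2, (ipr_gap_mem hj hy).1]
  · exact (ipr_gap_strictAntiOn hk).antitoneOn hy hz ((optT_strictMonoOn hk).le_iff_le hy hz |>.1 h)
  · have h1 := (optT_mem hj hy).1
    have h2 := (optT_mem hk hz).2
    obtain rfl : k = j + 1 := by
      by_contra hne
      have := crit_lt (j := j + 1) (k := k) (by omega) (by omega)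
      linarith
    have h0 : (0 : ℝ) ≤ 1 / j := by positivity
    have h0' : (0 : ℝ) ≤ 1 / (j + 1 : ℕ) := by positivity
    have ey : y = 0 := (optT_strictMonoOn hj).injOn hy ⟨le_rfl, h0⟩ (by rw [optT_zero hj]; linarith)
    have ez : z = 1 / (j + 1 : ℕ) :=
      (optT_strictMonoOn hk).injOn hz ⟨h0', le_rfl⟩ (by rw [optT_inv hk]; linarith)
    rw [ez, ey, gap_inv hk, gap_zero, ipr_inv hk, ipr_zero]
    push_cast
    exact le_rfl

/-! ### Evaluation of the tradeoff curve -/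

lemma rate_eq_odds {n : ℕ} {p : Fin n → ℝ} (hp : ∀ i, p i < 1) (i : Fin n) :
    rate p i = p i / (1 - p i) * ∏ j, (1 - p j) := by
  have := sub_pos.2 (hp i)
  rw [rate, ← Finset.mul_prod_erase Finset.univ (fun j => 1 - p j) (Finset.mem_univ i)]
  field_simp

lemma tput_eq_odds {n : ℕ} {p : Fin n → ℝ} (hp : ∀ i, p i < 1) :
    tput p = (∑ i, p i / (1 - p i)) * ∏ j, (1 - p j) := by
  rw [tput, Finset.sum_mul]
  exact Finset.sum_congr rfl fun i _ => rate_eq_odds hp i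

lemma jain_rate_eq_odds {n : ℕ} {p : Fin n → ℝ} (hp : ∀ i, p i < 1) :
    jain (fun i => rate p i) =
      (∑ i, p i / (1 - p i)) ^ 2 / (n * ∑ i, (p i / (1 - p i)) ^ 2) := by
  have hP : 0 < ∏ j, (1 - p j) := Finset.prod_pos fun j _ => sub_pos.2 (hp j)
  simp only [jain, rate_eq_odds hp, mul_pow, ← Finset.sum_mul]
  rw [← mul_assoc, mul_div_mul_right _ _ (by positivity)]

lemma prod_one_add_odds {n : ℕ} {p : Fin n → ℝ} (hp : ∀ i, p i < 1) :
    ∏ i, (1 + p i / (1 - p i)) = (∏ j, (1 - p j))⁻¹ := by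
  rw [← Finset.prod_inv_distrib]
  refine Finset.prod_congr rfl fun i _ => ?_
  have := sub_pos.2 (hp i)
  field_simp
  ring

lemma exists_control {n k : ℕ} (hk : 1 ≤ k) (hkn : k + 1 ≤ n) {z : ℝ}
    (hz : z ∈ Set.Icc 0 (1 / (k : ℝ))) (hz1 : z < 1) :
    ∃ p : Fin n → ℝ, (∀ i, p i ∈ Set.Ico (0 : ℝ) 1) ∧ tput p = optT k z ∧
      jain (fun i => rate p i) = ipr k (gap k z) / n := by
  have h : (1 : ℝ) ≤ k := by exact_mod_cast hk
  have hkz := (lt_of_mem_Icc_inv hk hz).2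
  have hz0 := hz.1
  set q : ℝ := (1 + z) / (k + 1) with hq
  set b : ℝ := (1 - k * z) / (k + 1) with hb
  have hq0 : 0 ≤ q := by positivity
  have hb0 : 0 ≤ b := div_nonneg (by linarith) (by positivity)
  have hq1 : q < 1 := by rw [hq, div_lt_one (by positivity)]; linarith
  have hb1 : b < 1 := by rw [hb, div_lt_one (by positivity)]; nlinarith
  let i₀ : Fin n := ⟨0, by omega⟩
  obtain ⟨A, hA, hAk⟩ := Finset.exists_subset_card_eq (s := Finset.univ.erase i₀) (n := k)
    (by rw [Finset.card_erase_of_mem (Finset.mem_univ _), Finset.card_univ, Fintype.card_fin]; omega)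
  let p : Fin n → ℝ := fun i => if i = i₀ then b else if i ∈ A then q else 0
  have hi₀ : i₀ ∉ A := fun h => by simpa using hA h
  have hpA : ∀ i ∈ A, p i = q := by
    intro i hi
    have : i ≠ i₀ := by rintro rfl; exact hi₀ hi
    simp [p, this, hi]
  have hp0 : ∀ i, i ≠ i₀ → i ∉ A → p i = 0 := fun i h1 h2 => by simp [p, h1, h2]
  have hpi : p i₀ = b := by simp [p]
  have hp : ∀ i, p i ∈ Set.Ico (0 : ℝ) 1 := by
    intro i
    simp only [p]
    split_ifs
    exacts [⟨hb0, hb1⟩, ⟨hq0, hq1⟩, ⟨le_rfl, one_pos⟩]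
  have hp1 : ∀ i, p i < 1 := fun i => (hp i).2
  have hS := sum_two_level hi₀ hpA hp0 (fun x => x / (1 - x)) (by simp)
  have hQ := sum_two_level hi₀ hpA hp0 (fun x => (x / (1 - x)) ^ 2) (by simp)
  have hP := prod_two_level hi₀ hpA hp0 (fun x => 1 - x) (by simp)
  rw [hpi, hAk] at hS hQ hP
  have hkz' : 0 < k - z := by linarith
  have h1z : 0 < 1 + z := by linarith
  have eq1 : 1 - q = (k - z) / (k + 1) := by rw [hq]; field_simp; ring
  have eb1 : 1 - b = k * (1 + z) / (k + 1) := by rw [hb]; field_simp; ring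
  have eq2 : q / (1 - q) = (1 + z) / (k - z) := by rw [eq1, hq]; field_simp
  have eb2 : b / (1 - b) = (1 - k * z) / (k * (1 + z)) := by rw [eb1, hb]; field_simp
  simp only [eq2, eb2] at hS hQ
  simp only [eq1, eb1] at hP
  have hD := gap_denom_pos hk hz0
  refine ⟨p, hp, ?_, ?_⟩
  · rw [tput_eq_odds hp1, hS, hP, optT]
    obtain ⟨j, rfl⟩ : ∃ j, k = j + 1 := ⟨k - 1, by omega⟩
    rw [Nat.add_sub_cancel, pow_succ]
    generalize ((((j + 1 : ℕ) : ℝ) - z) / (((j + 1 : ℕ) : ℝ) + 1)) ^ j = Y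
    field_simp
    ring
  · have hn : (0 : ℝ) < n := by
      have : 0 < n := by omega
      exact_mod_cast this
    rw [jain_rate_eq_odds hp1, hS, hQ, ipr, gap]
    have h1 : 0 < k * ((1 + z) / (k - z)) ^ 2 + ((1 - k * z) / (k * (1 + z))) ^ 2 := by positivity
    obtain ⟨D, hDe⟩ : ∃ D, D = k + (k - 1) * z + k * z ^ 2 := ⟨_, rfl⟩
    rw [← hDe] at hD ⊢
    have h2 : 0 < 1 + k * ((k + 1) * z / D) ^ 2 := by positivity
    rw [div_div, div_eq_div_iff (by positivity) (by positivity)]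
    field_simp
    rw [hDe]
    ring

lemma tput_le_two_level {n : ℕ} (hn : 2 ≤ n) {p : Fin n → ℝ} (hp : ∀ i, p i ∈ Set.Ico (0 : ℝ) 1)
    (hT : 0 < tput p) :
    ∃ (k : ℕ) (z : ℝ), 1 ≤ k ∧ k + 1 ≤ n ∧ z ∈ Set.Icc 0 (1 / (k : ℝ)) ∧ tput p ≤ optT k z ∧
      jain (fun i => rate p i) = ipr k (gap k z) / n := by
  have hp1 : ∀ i, p i < 1 := fun i => (hp i).2
  have hP : 0 < ∏ j, (1 - p j) := Finset.prod_pos fun j _ => sub_pos.2 (hp1 j)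
  have hT' := tput_eq_odds hp1
  have hS : 0 < ∑ i, p i / (1 - p i) := by
    rw [hT'] at hT
    exact pos_of_mul_pos_left hT hP.le
  obtain ⟨k, a, b, hk, hkn, hb, hba, h1, h2, h3⟩ := exists_two_level_le hn
    (fun i => p i / (1 - p i)) (fun i => div_nonneg (hp i).1 (sub_nonneg.2 (hp1 i).le)) hS
  rw [prod_one_add_odds hp1] at h3
  have h : (1 : ℝ) ≤ k := by exact_mod_cast hk
  have hn0 : (0 : ℝ) < n := by
    have : 0 < n := by omega
    exact_mod_cast this
  rw [jain_rate_eq_odds hp1, hT', ← h1, ← h2]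
  rw [← h1] at hS
  have hd : (a - b) / (k * a + b) ∈ Set.Icc 0 (1 / (k : ℝ)) := by
    constructor
    · exact div_nonneg (sub_nonneg.2 hba) hS.le
    · rw [div_le_div_iff₀ hS (by linarith)]
      nlinarith
  obtain ⟨z, hz, hgap⟩ := exists_gap_eq hk hd
  have ha : 0 < a := by
    by_contra! ha
    nlinarith
  refine ⟨k, z, hk, hkn, hz, ?_, ?_⟩
  · refine le_trans ?_ (levelT_le_optT hk hz hS)
    rw [hgap, levelT]
    have e1 : 1 + (k * a + b) * (1 + (a - b) / (k * a + b)) / (k + 1) = 1 + a := by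
      field_simp; ring
    have e2 : 1 + (k * a + b) * (1 - k * ((a - b) / (k * a + b))) / (k + 1) = 1 + b := by
      field_simp; ring
    rw [e1, e2, div_eq_mul_inv]
    gcongr
    exact (le_inv_comm₀ (by positivity) hP).1 h3
  · rw [hgap, ipr]
    have h4 : 0 < k * a ^ 2 + b ^ 2 := by positivity
    have h5 : 0 < 1 + k * ((a - b) / (k * a + b)) ^ 2 := by positivity
    rw [div_div, div_eq_div_iff (by positivity) (by positivity)]
    field_simp
    ring

lemma crit_pos {k : ℕ} (hk : 1 ≤ k) : 0 < crit k := by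
  rcases hk.eq_or_lt with rfl | hk
  · simp [crit]
  · have h : (1 : ℝ) < k := by exact_mod_cast hk
    have : 0 < 1 - 1 / (k : ℝ) := by rw [sub_pos, div_lt_one (by linarith)]; exact h
    unfold crit
    positivity

lemma FJstar_optT {n k : ℕ} (hk : 1 ≤ k) (hkn : k + 1 ≤ n) {z : ℝ}
    (hz : z ∈ Set.Icc 0 (1 / (k : ℝ))) (hz1 : z < 1) :
    FJstar n (optT k z) = ipr k (gap k z) / n := by
  refine IsGreatest.csSup_eq ⟨?_, ?_⟩
  · obtain ⟨p, hp, h1, h2⟩ := exists_control hk hkn hz hz1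
    exact ⟨p, hp, h1, h2.symm⟩
  · rintro v ⟨p, hp, h1, rfl⟩
    have hpos : 0 < tput p := by
      rw [h1]
      exact (crit_pos (by omega)).trans_le (optT_mem hk hz).1
    obtain ⟨j, y, hj, hjn, hy, h2, h3⟩ := tput_le_two_level (by omega) hp hpos
    rw [h3]
    gcongr
    exact ipr_le_of_optT_le hk hj hz hy (h1 ▸ h2)

/-! ### Convexity of the individual pieces -/

/-- The gap of a two-level configuration with inverse participation ratio `r`. -/
noncomputable def gapOfIpr (k : ℕ) (r : ℝ) : ℝ := √((k + 1 - r) / (k * r))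

lemma gapOfIpr_ipr {k : ℕ} (hk : 1 ≤ k) {d : ℝ} (hd : 0 ≤ d) : gapOfIpr k (ipr k d) = d := by
  have h : (0 : ℝ) < k := by exact_mod_cast hk
  have e : (k + 1 - ipr k d) / (k * ipr k d) = d ^ 2 := by
    unfold ipr
    field_simp
    ring
  rw [gapOfIpr, e, Real.sqrt_sq hd]

lemma gapOfIpr_strictAntiOn {k : ℕ} (hk : 1 ≤ k) :
    StrictAntiOn (gapOfIpr k) (Set.Icc (k : ℝ) (k + 1)) := by
  intro x hx y hy hxy
  have h : (0 : ℝ) < k := by exact_mod_cast hk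
  have hx0 : 0 < x := h.trans_le hx.1
  have hy0 : 0 < y := hx0.trans hxy
  refine Real.sqrt_lt_sqrt (div_nonneg (by linarith [hy.2]) (by positivity)) ?_
  rw [div_lt_div_iff₀ (by positivity) (by positivity)]
  have : 0 < k * ((k + 1) * (y - x)) := by
    have := sub_pos.2 hxy
    positivity
  nlinarith

lemma gapOfIpr_mem {k : ℕ} (hk : 1 ≤ k) {r : ℝ} (hr : r ∈ Set.Icc (k : ℝ) (k + 1)) :
    gapOfIpr k r ∈ Set.Icc 0 (1 / (k : ℝ)) := by
  have h : (0 : ℝ) < k := by exact_mod_cast hk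
  refine ⟨Real.sqrt_nonneg _, ?_⟩
  have := (gapOfIpr_strictAntiOn hk).antitoneOn ⟨le_rfl, by linarith⟩ hr hr.1
  rwa [← ipr_inv hk, gapOfIpr_ipr hk (by positivity)] at this

lemma ipr_gapOfIpr {k : ℕ} (hk : 1 ≤ k) {r : ℝ} (hr : r ∈ Set.Icc (k : ℝ) (k + 1)) :
    ipr k (gapOfIpr k r) = r := by
  have h : (0 : ℝ) < k := by exact_mod_cast hk
  have hr0 : 0 < r := h.trans_le hr.1
  rw [ipr, gapOfIpr, Real.sq_sqrt (div_nonneg (by linarith [hr.2]) (by positivity))]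
  field_simp
  ring

lemma gapOfIpr_continuousOn {k : ℕ} (hk : 1 ≤ k) :
    ContinuousOn (gapOfIpr k) (Set.Icc (k : ℝ) (k + 1)) := by
  have h : (0 : ℝ) < k := by exact_mod_cast hk
  refine Real.continuous_sqrt.comp_continuousOn (ContinuousOn.div (by fun_prop) (by fun_prop) ?_)
  intro r hr
  have : 0 < r := h.trans_le hr.1
  positivity

lemma levelT_continuousOn {k : ℕ} (hk : 1 ≤ k) {S : ℝ} (hS : 0 < S) :
    ContinuousOn (levelT k S) (Set.Icc 0 (1 / (k : ℝ))) := by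
  unfold levelT
  refine ContinuousOn.div (by fun_prop) (by fun_prop) fun d hd => ?_
  have h := one_le_level hk hS hd
  have p1 : 0 < 1 + S * (1 + d) / (k + 1) := by linarith
  have p2 : 0 < 1 + S * (1 - k * d) / (k + 1) := by linarith
  positivity

lemma levelT_gapOfIpr_hasDerivAt {k : ℕ} (hk : 1 ≤ k) {S : ℝ} (hS : 0 < S) {r : ℝ}
    (hr : r ∈ Set.Ioo (k : ℝ) (k + 1)) :
    HasDerivAt (fun r => levelT k S (gapOfIpr k r))
      (-(S ^ 3 / (2 * r ^ 2 * ((1 + S * (1 + gapOfIpr k r) / (k + 1)) ^ k *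
        (1 + S * (1 - k * gapOfIpr k r) / (k + 1))) *
        ((1 + S * (1 + gapOfIpr k r) / (k + 1)) * (1 + S * (1 - k * gapOfIpr k r) / (k + 1)))))) r := by
  have h : (0 : ℝ) < k := by exact_mod_cast hk
  have hr0 : 0 < r := h.trans hr.1
  have hlt := sub_pos.2 hr.2
  have hq : 0 < (k + 1 - r) / (k * r) := by positivity
  have hd0 : 0 < gapOfIpr k r := Real.sqrt_pos.2 hq
  have hinner : HasDerivAt (fun r : ℝ => (k + 1 - r) / (k * r))
      ((-1 * (k * r) - (k + 1 - r) * (k * 1)) / (k * r) ^ 2) r :=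
    ((hasDerivAt_id r).const_sub ((k : ℝ) + 1)).div ((hasDerivAt_id r).const_mul (k : ℝ)) (by positivity)
  have hgap : HasDerivAt (gapOfIpr k) _ r := hinner.sqrt hq.ne'
  have hlev := one_le_level hk hS (gapOfIpr_mem hk (Set.Ioo_subset_Icc_self hr))
  have p1 : 0 < 1 + S * (1 + gapOfIpr k r) / (k + 1) := by linarith
  have p2 : 0 < 1 + S * (1 - k * gapOfIpr k r) / (k + 1) := by linarith
  have hN := (level_hasDerivAt hk S (gapOfIpr k r)).comp r hgap
  have := (hasDerivAt_const r S).div hN (by simp only [Function.comp]; positivity)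
  refine this.congr_deriv ?_
  simp only [Function.comp]
  rw [show √((k + 1 - r) / (k * r)) = gapOfIpr k r from rfl]
  generalize gapOfIpr k r = d at *
  generalize 1 + S * (1 + d) / (k + 1) = A at *
  generalize 1 + S * (1 - k * d) / (k + 1) = B at *
  obtain ⟨j, rfl⟩ : ∃ j, k = j + 1 := ⟨k - 1, by omega⟩
  rw [Nat.add_sub_cancel, pow_succ]
  field_simp
  ring

lemma levelT_gapOfIpr_strictConvexOn {k : ℕ} (hk : 1 ≤ k) {S : ℝ} (hS : 0 < S) :
    StrictConvexOn ℝ (Set.Icc (k : ℝ) (k + 1)) (fun r => levelT k S (gapOfIpr k r)) := by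
  refine StrictMonoOn.strictConvexOn_of_deriv (convex_Icc _ _)
    ((levelT_continuousOn hk hS).comp (gapOfIpr_continuousOn hk) fun r hr => gapOfIpr_mem hk hr) ?_
  rw [interior_Icc]
  intro x hx y hy hxy
  rw [(levelT_gapOfIpr_hasDerivAt hk hS hx).deriv, (levelT_gapOfIpr_hasDerivAt hk hS hy).deriv,
    neg_lt_neg_iff]
  have h : (1 : ℝ) ≤ k := by exact_mod_cast hk
  have hx0 : 0 < x := by linarith [hx.1]
  have hx' := Set.Ioo_subset_Icc_self hx
  have hy' := Set.Ioo_subset_Icc_self hy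
  have hmx := gapOfIpr_mem hk hx'
  have hmy := gapOfIpr_mem hk hy'
  have hd := gapOfIpr_strictAntiOn hk hx' hy' hxy
  have hN := level_strictAntiOn hk hS hmy hmx hd
  have lx := one_le_level hk hS hmx
  have ly := one_le_level hk hS hmy
  simp only at hN
  have hAB : (1 + S * (1 + gapOfIpr k x) / (k + 1)) * (1 + S * (1 - k * gapOfIpr k x) / (k + 1)) ≤
      (1 + S * (1 + gapOfIpr k y) / (k + 1)) * (1 + S * (1 - k * gapOfIpr k y) / (k + 1)) := by
    have e : ∀ d : ℝ, (1 + S * (1 + d) / (k + 1)) * (1 + S * (1 - k * d) / (k + 1)) =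
        1 + S / (k + 1) * (2 - (k - 1) * d) + (S / (k + 1)) ^ 2 * (1 - (k - 1) * d - k * d ^ 2) := by
      intro d; ring
    rw [e, e]
    have hy0 := hmy.1
    have hk1 := sub_nonneg.2 h
    gcongr
  have a1 : 0 < 1 + S * (1 + gapOfIpr k x) / (k + 1) := by linarith
  have a2 : 0 < 1 + S * (1 - k * gapOfIpr k x) / (k + 1) := by linarith
  have b1 : 0 < 1 + S * (1 + gapOfIpr k y) / (k + 1) := by linarith
  have b2 : 0 < 1 + S * (1 - k * gapOfIpr k y) / (k + 1) := by linarith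
  refine div_lt_div_of_pos_left (by positivity) (by positivity) ?_
  refine mul_lt_mul ?_ hAB (by positivity) (by positivity)
  refine mul_lt_mul (by gcongr) hN.le (by positivity) (by positivity)

lemma exists_optT_eq_of_mem_Ico {k : ℕ} (hk : 1 ≤ k) {θ : ℝ}
    (hθ : θ ∈ Set.Ico (crit (k + 1)) (crit k)) :
    ∃ z ∈ Set.Icc 0 (1 / (k : ℝ)), z < 1 / k ∧ optT k z = θ := by
  have h : (0 : ℝ) ≤ 1 / k := by positivity
  have := intermediate_value_Ico h (optT_continuousOn k _)
  rw [optT_zero hk, optT_inv hk] at this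
  obtain ⟨z, hz, rfl⟩ := this hθ
  exact ⟨z, Set.Ico_subset_Icc_self hz, hz.2, rfl⟩

lemma one_div_natCast_le_one {k : ℕ} (hk : 1 ≤ k) : 1 / (k : ℝ) ≤ 1 := by
  have h : (1 : ℝ) ≤ k := by exact_mod_cast hk
  rw [div_le_one (by linarith)]
  exact h

lemma exists_ipr_gap_eq {k : ℕ} (hk : 1 ≤ k) {r : ℝ} (hr : r ∈ Set.Ioc (k : ℝ) (k + 1)) :
    ∃ z ∈ Set.Icc 0 (1 / (k : ℝ)), z < 1 / k ∧ ipr k (gap k z) = r := by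
  obtain ⟨z, hz, hgap⟩ := exists_gap_eq hk (gapOfIpr_mem hk (Set.Ioc_subset_Icc_self hr))
  have hzr : ipr k (gap k z) = r := by rw [hgap, ipr_gapOfIpr hk (Set.Ioc_subset_Icc_self hr)]
  refine ⟨z, hz, lt_of_le_of_ne hz.2 ?_, hzr⟩
  rintro rfl
  rw [gap_inv hk, ipr_inv hk] at hzr
  exact hr.1.ne hzr

lemma lt_ipr_gap {k : ℕ} (hk : 1 ≤ k) {z : ℝ} (hz : z ∈ Set.Icc 0 (1 / (k : ℝ)))
    (hz1 : z < 1 / k) : (k : ℝ) < ipr k (gap k z) := by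
  have h : (0 : ℝ) ≤ 1 / k := by positivity
  have := ipr_gap_strictAntiOn hk hz ⟨h, le_rfl⟩ hz1
  simpa only [gap_inv hk, ipr_inv hk] using this

lemma FJstar_strictConvexOn {n k : ℕ} (hk : 1 ≤ k) (hkn : k + 1 ≤ n) :
    StrictConvexOn ℝ (Set.Ico (crit (k + 1)) (crit k)) (FJstar n) := by
  refine ⟨convex_Ico _ _, ?_⟩
  intro x hx y hy hxy a b ha hb hab
  obtain ⟨w, hw, hw1, hwe⟩ := exists_optT_eq_of_mem_Ico hk
    ((convex_Ico _ _) hx hy ha.le hb.le hab)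
  obtain ⟨z₁, hz₁, hz₁', rfl⟩ := exists_optT_eq_of_mem_Ico hk hx
  obtain ⟨z₂, hz₂, hz₂', rfl⟩ := exists_optT_eq_of_mem_Ico hk hy
  have hk1 := one_div_natCast_le_one hk
  rw [← hwe, FJstar_optT hk hkn hz₁ (by linarith), FJstar_optT hk hkn hz₂ (by linarith),
    FJstar_optT hk hkn hw (by linarith)]
  simp only [smul_eq_mul] at hwe ⊢
  have h₁ := lt_ipr_gap hk hz₁ hz₁'
  have h₂ := lt_ipr_gap hk hz₂ hz₂'
  have h₁' := (ipr_gap_mem hk hz₁).2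
  have h₂' := (ipr_gap_mem hk hz₂).2
  set r₁ := ipr k (gap k z₁) with hr₁
  set r₂ := ipr k (gap k z₂) with hr₂
  have hrr : r₁ ≠ r₂ := fun h =>
    hxy (by rw [(ipr_gap_strictAntiOn hk).injOn hz₁ hz₂ h])
  have hr : a * r₁ + b * r₂ ∈ Set.Ioc (k : ℝ) (k + 1) :=
    (convex_Ioc _ _) ⟨h₁, h₁'⟩ ⟨h₂, h₂'⟩ ha.le hb.le hab
  obtain ⟨z, hz, hz1, hze⟩ := exists_ipr_gap_eq hk hr
  have hS := optS_pos hk hz (by linarith)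
  have hconv := (levelT_gapOfIpr_strictConvexOn hk hS).2 ⟨h₁.le, h₁'⟩ ⟨h₂.le, h₂'⟩ hrr ha hb hab
  simp only [smul_eq_mul] at hconv
  rw [← hze, hr₁, hr₂, gapOfIpr_ipr hk (gap_mem hk hz).1, gapOfIpr_ipr hk (gap_mem hk hz₁).1,
    gapOfIpr_ipr hk (gap_mem hk hz₂).1, levelT_optS hk hz (by linarith)] at hconv
  have hlt : optT k z < optT k w := by
    rw [hwe]
    refine hconv.trans_le ?_
    have := levelT_le_optT hk hz₁ hS
    have := levelT_le_optT hk hz₂ hS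
    gcongr
  have hzw := (optT_strictMonoOn hk).lt_iff_lt hz hw |>.1 hlt
  have hfin : ipr k (gap k w) < ipr k (gap k z) := ipr_gap_strictAntiOn hk hz hw hzw
  rw [hze] at hfin
  have hn : (0 : ℝ) < n := by
    have : 0 < n := by omega
    exact_mod_cast this
  rw [← mul_div_assoc, ← mul_div_assoc, ← add_div]
  gcongr

/-! ### Continuity -/

lemma exists_optT_eq {n : ℕ} (hn : 2 ≤ n) {θ : ℝ} (hθ : θ ∈ Set.Ico (crit n) 1) :
    ∃ (k : ℕ) (z : ℝ), 1 ≤ k ∧ k + 1 ≤ n ∧ z ∈ Set.Icc 0 (1 / (k : ℝ)) ∧ z < 1 / k ∧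
      optT k z = θ := by
  induction n, hn using Nat.le_induction with
  | base =>
    obtain ⟨z, hz, hz1, h⟩ := exists_optT_eq_of_mem_Ico le_rfl (θ := θ)
      ⟨hθ.1, by simpa [crit] using hθ.2⟩
    exact ⟨1, z, le_rfl, le_rfl, hz, hz1, h⟩
  | succ n hn ih =>
    rcases le_or_gt (crit n) θ with h | h
    · obtain ⟨k, z, h1, h2, h3⟩ := ih ⟨h, hθ.2⟩
      exact ⟨k, z, h1, by omega, h3⟩
    · obtain ⟨z, hz, hz1, h⟩ := exists_optT_eq_of_mem_Ico (by omega) (θ := θ) ⟨hθ.1, h⟩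
      exact ⟨n, z, by omega, le_rfl, hz, hz1, h⟩

lemma FJstar_continuousOn {n : ℕ} (hn : 2 ≤ n) : ContinuousOn (FJstar n) (Set.Ico (crit n) 1) := by
  have hn0 : (0 : ℝ) < n := by
    have : 0 < n := by omega
    exact_mod_cast this
  have hmaps : ∀ θ ∈ Set.Ico (crit n) 1, FJstar n θ ∈ Set.Ioc (1 / (n : ℝ)) 1 := by
    intro θ hθ
    obtain ⟨k, z, hk, hkn, hz, hz1, rfl⟩ := exists_optT_eq hn hθ
    have h1 := one_div_natCast_le_one hk
    have h2 := lt_ipr_gap hk hz hz1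
    have h3 := (ipr_gap_mem hk hz).2
    have hk' : (1 : ℝ) ≤ k := by exact_mod_cast hk
    have hkn' : (k : ℝ) + 1 ≤ n := by exact_mod_cast hkn
    rw [FJstar_optT hk hkn hz (by linarith)]
    constructor
    · gcongr
      linarith
    · rw [div_le_one hn0]
      linarith
  let g : Set.Ico (crit n) 1 → (Set.Ioc (1 / (n : ℝ)) 1)ᵒᵈ := fun θ =>
    OrderDual.toDual ⟨FJstar n θ, hmaps θ θ.2⟩
  have hmono : Monotone g := by
    rintro ⟨x, hx⟩ ⟨y, hy⟩ hxy
    change FJstar n y ≤ FJstar n x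
    have hxy : x ≤ y := hxy
    obtain ⟨j, v, hj, hjn, hv, hv1, rfl⟩ := exists_optT_eq hn hx
    obtain ⟨k, w, hk, hkn, hw, hw1, rfl⟩ := exists_optT_eq hn hy
    have h1 := one_div_natCast_le_one hj
    have h2 := one_div_natCast_le_one hk
    rw [FJstar_optT hk hkn hw (by linarith), FJstar_optT hj hjn hv (by linarith)]
    gcongr
    exact ipr_le_of_optT_le hj hk hv hw hxy
  have hsurj : Function.Surjective g := by
    intro v
    obtain ⟨v, hv⟩ := v
    have hr1 : 1 < v * n := by
      have := hv.1
      rwa [div_lt_iff₀ hn0] at this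
    have hrn : v * n ≤ n := by nlinarith [hv.2]
    have hceil : 1 < ⌈v * n⌉₊ := by rw [Nat.lt_ceil]; exact_mod_cast hr1
    have hceil' : ⌈v * n⌉₊ ≤ n := Nat.ceil_le.2 hrn
    obtain ⟨k, hk⟩ : ∃ k, ⌈v * n⌉₊ = k + 1 := ⟨⌈v * n⌉₊ - 1, by omega⟩
    have hk1 : 1 ≤ k := by omega
    have hkr : v * n ∈ Set.Ioc (k : ℝ) (k + 1) := by
      constructor
      · rw [← Nat.lt_ceil]; omega
      · have := Nat.le_ceil (v * n)
        rw [hk] at this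
        exact_mod_cast this
    obtain ⟨z, hz, hz1, hze⟩ := exists_ipr_gap_eq hk1 hkr
    have h1 := one_div_natCast_le_one hk1
    have hle : crit n ≤ crit (k + 1) := by
      rcases (show k + 1 ≤ n by omega).eq_or_lt with h | h
      · rw [h]
      · exact (crit_lt (by omega) h).le
    have hlt : optT k z < 1 := by
      have h0 : (0 : ℝ) ≤ 1 / k := by positivity
      have h2 := optT_strictMonoOn hk1 hz ⟨h0, le_rfl⟩ hz1
      rw [optT_inv hk1] at h2
      have h3 : crit k ≤ crit 1 := by
        rcases hk1.eq_or_lt with h | h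
        · rw [h]
        · exact (crit_lt le_rfl h).le
      have h4 : crit 1 = 1 := by simp [crit]
      linarith
    refine ⟨⟨optT k z, hle.trans (optT_mem hk1 hz).1, hlt⟩, ?_⟩
    change OrderDual.toDual _ = OrderDual.toDual _
    congr 2
    change FJstar n (optT k z) = v
    rw [FJstar_optT hk1 (by omega) hz (by linarith), hze]
    field_simp
  have hcont := hmono.continuous_of_surjective hsurj
  rw [continuousOn_iff_continuous_domRestrict]
  exact continuous_subtype_val.comp (continuous_ofDual.comp hcont)

/-! ### Kinks at the critical throughputs -/

open Filter Topology

lemma optT_hasDerivAt {k : ℕ} (hk : 1 ≤ k) {z : ℝ} (hz : z < k) :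
    HasDerivAt (optT k) (k * z * (1 - z) / (k - z) * ((k - z) / (k + 1)) ^ (k - 1)) z := by
  have hz' := sub_pos.2 hz
  have hD : HasDerivAt (fun z : ℝ => (k + (k - 1) * z + k * z ^ 2) / ((k : ℝ) + 1))
      (((k - 1) * 1 + k * (2 * z)) / (k + 1)) z := by
    have := ((((hasDerivAt_id z).const_mul ((k : ℝ) - 1)).const_add (k : ℝ)).add
      ((hasDerivAt_pow 2 z).const_mul (k : ℝ))).div_const ((k : ℝ) + 1)
    simpa using this
  have hY : HasDerivAt (fun z : ℝ => ((k : ℝ) - z) / (k + 1)) (-1 / (k + 1)) z :=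
    ((hasDerivAt_id z).const_sub (k : ℝ)).div_const _
  refine (hD.mul (hY.pow (k - 1))).congr_deriv ?_
  obtain ⟨j, rfl⟩ : ∃ j, k = j + 1 := ⟨k - 1, by omega⟩
  rcases j with _ | j
  · simp at hz' ⊢
    have h1z : 1 - z ≠ 0 := (sub_pos.2 hz').ne'
    field_simp
    ring
  · simp only [Nat.add_sub_cancel, Pi.pow_apply]
    rw [pow_succ]
    generalize ((((j + 1 + 1 : ℕ) : ℝ) - z) / (((j + 1 + 1 : ℕ) : ℝ) + 1)) ^ j = Y
    push_cast at *
    field_simp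
    ring

lemma ipr_gap_hasDerivAt_inv {k : ℕ} (hk : 1 ≤ k) :
    HasDerivAt (fun z => ipr k (gap k z)) (-(2 * k * (k - 1) / (k + 1))) (1 / k) := by
  have h : (0 : ℝ) < k := by exact_mod_cast hk
  have hpos := gap_denom_pos hk (z := 1 / k) (by positivity)
  have hD : HasDerivAt (fun z : ℝ => (k + (k - 1) * z + k * z ^ 2 : ℝ))
      ((k - 1) * 1 + k * (2 * (1 / k))) (1 / k) := by
    have := (((hasDerivAt_id (1 / (k : ℝ))).const_mul ((k : ℝ) - 1)).const_add (k : ℝ)).add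
      ((hasDerivAt_pow 2 (1 / (k : ℝ))).const_mul (k : ℝ))
    exact this.congr_deriv (by simp)
  have hg : HasDerivAt (gap k) (1 - 1 / k) (1 / k) := by
    refine (((hasDerivAt_id (1 / (k : ℝ))).const_mul ((k : ℝ) + 1)).div hD hpos.ne').congr_deriv ?_
    have e : k + (k - 1) * (1 / k) + k * (1 / k : ℝ) ^ 2 = k + 1 := by field_simp; ring
    simp only [e, id]
    field_simp
    ring
  have hI : HasDerivAt (ipr k) (-((k + 1) * (k * (2 * (1 / k))) / (1 + k * (1 / k) ^ 2) ^ 2))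
      (gap k (1 / k)) := by
    rw [gap_inv hk]
    have h1 := ((hasDerivAt_pow 2 (1 / (k : ℝ))).const_mul (k : ℝ)).const_add 1
    refine ((hasDerivAt_const (1 / (k : ℝ)) ((k : ℝ) + 1)).div h1 (by positivity)).congr_deriv ?_
    simp
    ring
  refine (hI.comp (1 / (k : ℝ)) hg).congr_deriv ?_
  field_simp

lemma tendsto_optT_sub_div_sq {k : ℕ} (hk : 1 ≤ k) :
    Tendsto (fun z => (optT k z - crit (k + 1)) / z ^ 2) (𝓝[>] 0)
      (𝓝 (((k : ℝ) / (k + 1)) ^ (k - 1) / 2)) := by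
  have h : (0 : ℝ) < k := by exact_mod_cast hk
  refine HasDerivAt.lhopital_zero_nhdsGT
    (f' := fun z => k * z * (1 - z) / (k - z) * ((k - z) / (k + 1)) ^ (k - 1))
    (g' := fun z => 2 * z) ?_ ?_ ?_ ?_ ?_ ?_
  · filter_upwards [mem_nhdsWithin_of_mem_nhds (Iio_mem_nhds h)] with z hz
    exact (optT_hasDerivAt hk hz).sub_const _
  · exact Eventually.of_forall fun z => by simpa using hasDerivAt_pow 2 z
  · filter_upwards [self_mem_nhdsWithin] with z hz
    have hz : 0 < z := hz
    positivity
  · rw [← optT_zero hk]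
    have hc : Continuous fun z => optT k z - optT k 0 := by unfold optT; fun_prop
    simpa using (hc.tendsto 0).mono_left nhdsWithin_le_nhds
  · have hc : Continuous fun z : ℝ => z ^ 2 := by fun_prop
    simpa using (hc.tendsto 0).mono_left nhdsWithin_le_nhds
  · have hc : ContinuousAt
        (fun z : ℝ => k * (1 - z) / (2 * (k - z)) * ((k - z) / ((k : ℝ) + 1)) ^ (k - 1)) 0 := by
      refine ContinuousAt.mul (ContinuousAt.div (by fun_prop) (by fun_prop) ?_) (by fun_prop)
      simpa using h.ne'
    have hlim := hc.tendsto.mono_left (nhdsWithin_le_nhds (s := Set.Ioi 0))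
    have e : (k : ℝ) * (1 - 0) / (2 * (k - 0)) * ((k - 0) / ((k : ℝ) + 1)) ^ (k - 1) =
        ((k : ℝ) / (k + 1)) ^ (k - 1) / 2 := by
      rw [sub_zero, sub_zero]
      field_simp
    rw [e] at hlim
    refine hlim.congr' ?_
    filter_upwards [self_mem_nhdsWithin, mem_nhdsWithin_of_mem_nhds (Iio_mem_nhds h)] with z hz hz'
    have hz : 0 < z := hz
    have hz' := sub_pos.2 (show z < k from hz')
    field_simp

lemma tendsto_ipr_gap_sub_div_sq {k : ℕ} (hk : 1 ≤ k) :
    Tendsto (fun z => (ipr k (gap k z) - (k + 1)) / z ^ 2) (𝓝[>] 0)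
      (𝓝 (-(((k : ℝ) + 1) ^ 3 / k))) := by
  have h : (0 : ℝ) < k := by exact_mod_cast hk
  have hc : ContinuousAt (fun z : ℝ => -((k : ℝ) * (k + 1) ^ 3 / ((k + (k - 1) * z + k * z ^ 2) ^ 2 *
      (1 + k * gap k z ^ 2)))) 0 := by
    have hg : ContinuousAt (gap k) 0 := by
      unfold gap
      exact ContinuousAt.div (by fun_prop) (by fun_prop) (gap_denom_pos hk le_rfl).ne'
    refine (ContinuousAt.div (by fun_prop) (by fun_prop) ?_).neg
    have := gap_denom_pos hk (le_refl (0 : ℝ))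
    positivity
  have hlim := hc.tendsto.mono_left (nhdsWithin_le_nhds (s := Set.Ioi 0))
  have e : -((k : ℝ) * (k + 1) ^ 3 / ((k + (k - 1) * 0 + k * 0 ^ 2) ^ 2 * (1 + k * gap k 0 ^ 2))) =
      -(((k : ℝ) + 1) ^ 3 / k) := by
    rw [gap_zero]
    simp only [mul_zero, add_zero, ne_eq, OfNat.ofNat_ne_zero, not_false_eq_true, zero_pow]
    field_simp
  rw [e] at hlim
  refine hlim.congr' ?_
  filter_upwards [self_mem_nhdsWithin] with z hz
  have hz : 0 < z := hz
  have hD := gap_denom_pos hk hz.le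
  unfold ipr gap
  obtain ⟨D, hDe⟩ : ∃ D, D = k + (k - 1) * z + k * z ^ 2 := ⟨_, rfl⟩
  rw [← hDe] at hD ⊢
  field_simp
  ring

lemma FJstar_left_slope {n k : ℕ} (hk : 2 ≤ k) (hkn : k + 1 ≤ n) {d : ℝ}
    (hd : HasDerivAt (FJstar n) d (crit k)) : n * d * crit k = -(2 * k * (k - 1)) := by
  have hk1 : 1 ≤ k := by omega
  have h : (2 : ℝ) ≤ k := by exact_mod_cast hk
  have hn0 : (0 : ℝ) < n := by
    have : 0 < n := by omega
    exact_mod_cast this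
  have hinv : 1 / (k : ℝ) < 1 := by rw [div_lt_one] <;> linarith
  have h0 : (0 : ℝ) < 1 / k := by positivity
  have hmem : 1 / (k : ℝ) ∈ Set.Icc 0 (1 / (k : ℝ)) := ⟨h0.le, le_rfl⟩
  have hT := optT_hasDerivAt hk1 (z := 1 / k) (by linarith)
  rw [← optT_inv hk1] at hd
  have h1 := (hd.comp _ hT).hasDerivWithinAt (s := Set.Icc 0 (1 / (k : ℝ)))
  have h2 := ((ipr_gap_hasDerivAt_inv hk1).div_const (n : ℝ)).hasDerivWithinAt
    (s := Set.Icc 0 (1 / (k : ℝ)))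
  have h3 := h1.congr_of_mem (f₁ := fun z => ipr k (gap k z) / n)
    (fun z hz => (FJstar_optT hk1 hkn hz (hz.2.trans_lt hinv)).symm) hmem
  have huniq := UniqueDiffWithinAt.eq_deriv _ (uniqueDiffOn_Icc h0 _ hmem) h2 h3
  have e2 : (k - 1 / (k : ℝ)) / (k + 1) = 1 - 1 / k := by field_simp; ring
  rw [e2, show (1 - 1 / (k : ℝ)) ^ (k - 1) = crit k from rfl] at huniq
  have e3 : (k : ℝ) * (1 / k) * (1 - 1 / k) / (k - 1 / k) = 1 / (k + 1) := by
    have : (k : ℝ) - 1 / k ≠ 0 := (by linarith : (0 : ℝ) < k - 1 / k).ne'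
    rw [div_eq_div_iff this (by positivity)]
    field_simp
    ring
  rw [e3] at huniq
  field_simp at huniq
  linarith

lemma FJstar_right_slope {n k : ℕ} (hk : 1 ≤ k) (hkn : k + 1 ≤ n) {d : ℝ}
    (hd : HasDerivAt (FJstar n) d (crit (k + 1))) :
    n * d * crit (k + 1) = -(2 * (k + 1) ^ 2) := by
  have h : (0 : ℝ) < k := by exact_mod_cast hk
  have hn0 : (0 : ℝ) < n := by
    have : 0 < n := by omega
    exact_mod_cast this
  have h0 : (0 : ℝ) < 1 / k := by positivity
  have hnear : ∀ᶠ z : ℝ in 𝓝[>] (0 : ℝ), 0 < z ∧ z < 1 / (k : ℝ) := by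
    filter_upwards [self_mem_nhdsWithin, mem_nhdsWithin_of_mem_nhds (Iio_mem_nhds h0)] with z h1 h2
    exact ⟨h1, h2⟩
  have hne : ∀ᶠ z in 𝓝[>] (0 : ℝ), optT k z ≠ crit (k + 1) := by
    filter_upwards [hnear] with z hz
    rw [← optT_zero hk]
    exact (optT_strictMonoOn hk ⟨le_rfl, h0.le⟩ ⟨hz.1.le, hz.2.le⟩ hz.1).ne'
  have hto : Tendsto (optT k) (𝓝[>] 0) (𝓝[≠] crit (k + 1)) := by
    refine tendsto_nhdsWithin_iff.2 ⟨?_, hne⟩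
    have hc : Continuous (optT k) := by unfold optT; fun_prop
    rw [← optT_zero hk]
    exact (hc.tendsto 0).mono_left nhdsWithin_le_nhds
  have h1 := ((hasDerivAt_iff_tendsto_slope.1 hd).comp hto).mul (tendsto_optT_sub_div_sq hk)
  have h2 := (tendsto_ipr_gap_sub_div_sq hk).div_const (n : ℝ)
  have huniq := tendsto_nhds_unique_of_eventuallyEq h1 h2 (by
    filter_upwards [hnear, hne] with z hz hzne
    have hk1 := one_div_natCast_le_one hk
    have e1 := FJstar_optT hk hkn (z := z) ⟨hz.1.le, hz.2.le⟩ (by linarith [hz.2])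
    have e2 := FJstar_optT hk hkn (z := 0) ⟨le_rfl, h0.le⟩ one_pos
    rw [optT_zero hk, gap_zero, ipr_zero] at e2
    have hz0 := hz.1
    have hsub := sub_ne_zero.2 hzne
    simp only [Function.comp, slope_def_field]
    rw [e1, e2]
    field_simp)
  have hc : crit (k + 1) = (k / (k + 1)) * ((k : ℝ) / (k + 1)) ^ (k - 1) := by
    rw [← optT_zero hk, optT]
    simp
  rw [hc]
  generalize ((k : ℝ) / (k + 1)) ^ (k - 1) = Y at *
  field_simp at huniq ⊢
  linarith

theorem jain_tradeoff_regularity (n : ℕ) (hn : 2 ≤ n) :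
    ContinuousOn (FJstar n) (Set.Ico (crit n) 1) ∧
    (∀ t : ℕ, 2 ≤ t → t ≤ n →
      StrictConvexOn ℝ (Set.Ico (crit t) (crit (t - 1))) (FJstar n)) ∧
    (3 ≤ n → ∀ t : ℕ, 2 ≤ t → t ≤ n - 1 →
      ¬ DifferentiableAt ℝ (FJstar n) (crit t)) := by
  refine ⟨FJstar_continuousOn hn, fun t ht htn => ?_, fun _ t ht htn hdiff => ?_⟩
  · obtain ⟨k, rfl⟩ : ∃ k, t = k + 1 := ⟨t - 1, by omega⟩
    exact FJstar_strictConvexOn (by omega) htn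
  · obtain ⟨k, rfl⟩ : ∃ k, t = k + 1 := ⟨t - 1, by omega⟩
    have h1 := FJstar_left_slope ht (by omega) hdiff.hasDerivAt
    have h2 := FJstar_right_slope (by omega) (by omega) hdiff.hasDerivAt
    have hk : (0 : ℝ) ≤ k := k.cast_nonneg
    push_cast at h1
    nlinarith
end

section
/- (Theorem 4, regime 1: α-fair maximization below the critical throughput.) Let n ≥ 2, α ≥ 1, and θ ∈ (0, θ_n], where θ_n = (1 − 1/n)^{n−1}. Then there exists p̄ ∈ (0, 1/n] with p̄·(1−p̄)^{n−1} = θ/n, and the uniform control p* with all n components equal to p̄ satisfies T(x(p*)) = θ and maximizes F_α(x(p)) over all p ∈ (0,1)^n with T(x(p)) = θ; the maximum value equals −n·log(n/θ) if α = 1 and −(n/(α−1))·(n/θ)^{α−1} if α > 1 (every user receives rate θ/n at the optimum). -/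
open scoped BigOperators

/-- The `α`-fair objective (sum-user utility). -/
noncomputable def Falpha (α : ℝ) {n : ℕ} (x : Fin n → ℝ) : ℝ := ∑ i, Ualpha α (x i)

/-- The graph of `Ualpha α` lies below its tangent lines. -/
theorem Ualpha_le_tangent {α z m : ℝ} (hα : 1 ≤ α) (hz : 0 < z) (hm : 0 < m) :
    Ualpha α z ≤ Ualpha α m + m ^ (1 - α) * (z / m - 1) := by
  have hlog := Real.log_le_sub_one_of_pos (div_pos hz hm)
  rcases hα.eq_or_lt with rfl | hα'
  · rw [Real.log_div hz.ne' hm.ne'] at hlog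
    simp only [Ualpha, if_true, sub_self, Real.rpow_zero]
    linarith
  · have hneg : 1 - α < 0 := by linarith
    have hpow : 0 < m ^ (1 - α) := Real.rpow_pos_of_pos hm _
    have hz' : z ^ (1 - α) = m ^ (1 - α) * (z / m) ^ (1 - α) := by
      rw [← Real.mul_rpow hm.le (div_pos hz hm).le, mul_div_cancel₀ _ hm.ne']
    have hexp : 1 + (1 - α) * (z / m - 1) ≤ (z / m) ^ (1 - α) := by
      rw [Real.rpow_def_of_pos (div_pos hz hm)]
      nlinarith [Real.add_one_le_exp (Real.log (z / m) * (1 - α))]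
    have hmul := mul_le_mul_of_nonneg_left hexp hpow.le
    simp only [Ualpha, if_neg hα'.ne']
    rw [div_le_iff_of_neg hneg, hz', add_mul, div_mul_cancel₀ _ hneg.ne]
    linarith

/-- By concavity, equal rates maximize the `α`-fair objective for a given throughput. -/
theorem Falpha_le_Falpha_const {n : ℕ} {α m : ℝ} (hα : 1 ≤ α) (hm : 0 < m) {x : Fin n → ℝ}
    (hx : ∀ i, 0 < x i) (hsum : ∑ i, x i = n * m) :
    Falpha α x ≤ Falpha α fun _ : Fin n => m := by
  have hzero : ∑ i, m ^ (1 - α) * (x i / m - 1) = 0 := by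
    rw [← Finset.mul_sum, Finset.sum_sub_distrib, ← Finset.sum_div, hsum,
      mul_div_cancel_right₀ _ hm.ne']
    simp
  calc Falpha α x ≤ ∑ i, (Ualpha α m + m ^ (1 - α) * (x i / m - 1)) :=
        Finset.sum_le_sum fun i _ => Ualpha_le_tangent hα (hx i) hm
    _ = Falpha α fun _ : Fin n => m := by rw [Finset.sum_add_distrib, hzero, add_zero]; rfl

theorem rate_pos {n : ℕ} {p : Fin n → ℝ} (hp : ∀ i, p i ∈ Set.Ioo (0 : ℝ) 1) (i : Fin n) :
    0 < rate p i :=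
  mul_pos (hp i).1 (Finset.prod_pos fun j _ => sub_pos.2 (hp j).2)

theorem exists_mul_one_sub_pow_eq {n : ℕ} (hn : 0 < n) {θ : ℝ} (hθ0 : 0 < θ)
    (hθn : θ ≤ crit n) :
    ∃ q ∈ Set.Ioc (0 : ℝ) (1 / (n : ℝ)), q * (1 - q) ^ (n - 1) = θ / n := by
  have hn' : (0 : ℝ) < n := Nat.cast_pos.2 hn
  have hcont : ContinuousOn (fun q : ℝ => q * (1 - q) ^ (n - 1)) (Set.Icc 0 (1 / (n : ℝ))) := by
    fun_prop
  have hmem : θ / n ∈ Set.Ioc ((0 : ℝ) * (1 - 0) ^ (n - 1))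
      (1 / (n : ℝ) * (1 - 1 / (n : ℝ)) ^ (n - 1)) := by
    refine ⟨by rw [zero_mul]; positivity, ?_⟩
    rw [div_eq_inv_mul, one_div]
    rw [crit, one_div] at hθn
    gcongr
  exact intermediate_value_Ioc (by positivity) hcont hmem

theorem alpha_fair_regime_one (n : ℕ) (hn : 2 ≤ n) (α : ℝ) (hα : 1 ≤ α)
    (θ : ℝ) (hθ0 : 0 < θ) (hθn : θ ≤ crit n) :
    ∃ pbar : ℝ, pbar ∈ Set.Ioc (0:ℝ) (1 / (n : ℝ)) ∧
      pbar * (1 - pbar) ^ (n - 1) = θ / n ∧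
      tput (fun _ : Fin n => pbar) = θ ∧
      (∀ i : Fin n, rate (fun _ : Fin n => pbar) i = θ / n) ∧
      (∀ p : Fin n → ℝ, (∀ i, p i ∈ Set.Ioo (0:ℝ) 1) → tput p = θ →
        Falpha α (fun i => rate p i) ≤ Falpha α (fun i => rate (fun _ : Fin n => pbar) i)) ∧
      (α = 1 →
        Falpha α (fun i => rate (fun _ : Fin n => pbar) i) = -(n : ℝ) * Real.log ((n : ℝ) / θ)) ∧
      (1 < α →
        Falpha α (fun i => rate (fun _ : Fin n => pbar) i) =
          -((n : ℝ) / (α - 1)) * ((n : ℝ) / θ) ^ (α - 1)) := by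
  have hn' : (0 : ℝ) < n := by exact_mod_cast (by omega : 0 < n)
  have hm : 0 < θ / n := div_pos hθ0 hn'
  obtain ⟨q, hq, hqθ⟩ := exists_mul_one_sub_pow_eq (by omega) hθ0 hθn
  have hrate : ∀ i : Fin n, rate (fun _ : Fin n => q) i = θ / n := fun i => by
    rw [rate_const, hqθ]
  have hF : Falpha α (fun i => rate (fun _ : Fin n => q) i) = n * Ualpha α (θ / n) := by
    simp [Falpha, hrate]
  refine ⟨q, hq, hqθ, ?_, hrate, ?_, ?_, ?_⟩
  · simp only [tput, hrate, Finset.sum_const, Finset.card_univ, Fintype.card_fin, nsmul_eq_mul]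
    exact mul_div_cancel₀ _ hn'.ne'
  · intro p hp hsum
    simp only [hrate]
    refine Falpha_le_Falpha_const hα hm (rate_pos hp) ?_
    rw [mul_div_cancel₀ _ hn'.ne']
    exact hsum
  · intro h
    rw [hF, Ualpha, if_pos h, ← inv_div, Real.log_inv]
    ring
  · intro h
    rw [hF, Ualpha, if_neg h.ne', ← inv_div (n : ℝ) θ, Real.inv_rpow (by positivity),
      ← Real.rpow_neg (by positivity), neg_sub, ← neg_sub α 1, div_neg]
    ring
end
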